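/- arXiv:1510.00338 — 7 statements merged into one kernel-verified Lean document; each statement's English description precedes it below -/
import Mathlib

section
/- Let g : ℝⁿ → ℝⁿ be C² and h : ℝⁿ → ℝ be C³, both bounded with bounded derivatives up to the stated orders; set L_g h(x) := h'(x)·g(x) and L_g² h(x) := (L_g h)'(x)·g(x). Let S : ℝ → ℝ be bounded with |S| ≤ M_S, and let M > 0. Then there exists a constant C > 0 such that for every x̄ ∈ ℝⁿ, every σ ∈ ℝ, every ε ∈ (0,1], and every e ∈ ℝⁿ with ‖e‖ ≤ M ε², setting x := x̄ + ε g(x̄) S(σ) + e, one has |h(x) − ε L_g h(x) S(σ) − h(x̄)| ≤ C ε² and |L_g h(x) − ε L_g² h(x) S(σ) − L_g h(x̄)| ≤ C ε². (Consequently, the demodulated signals h(x) − ε L_g h(x) S(t/ε) and L_g h(x) − ε L_g² h(x) S(t/ε) recover h(x̄) and L_g h(x̄) up to O(ε²).) -/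
/-- A bound on the second derivative gives a Lipschitz estimate for `fderiv`. -/
theorem norm_fderiv_sub_le_of_norm_iteratedFDeriv_two_le
    {E F : Type*} [NormedAddCommGroup E] [NormedSpace ℝ E] [NormedAddCommGroup F]
    [NormedSpace ℝ F] {f : E → F} {K : ℝ} (hf : ContDiff ℝ 2 f)
    (hK : ∀ x, ‖iteratedFDeriv ℝ 2 f x‖ ≤ K) (x y : E) :
    ‖fderiv ℝ f y - fderiv ℝ f x‖ ≤ K * ‖y - x‖ := by
  have hd : Differentiable ℝ (fderiv ℝ f) :=
    (hf.fderiv_right (m := 1) (by norm_num)).differentiable (by norm_num)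
  refine convex_univ.norm_image_sub_le_of_norm_fderiv_le (𝕜 := ℝ) (fun z _ => hd z)
    (fun z _ => ?_) (Set.mem_univ x) (Set.mem_univ y)
  rw [← norm_iteratedFDeriv_one, norm_iteratedFDeriv_fderiv]
  exact hK z

/-- First-order Taylor estimate with a bounded second derivative. -/
theorem norm_sub_sub_fderiv_apply_le
    {E F : Type*} [NormedAddCommGroup E] [NormedSpace ℝ E] [NormedAddCommGroup F]
    [NormedSpace ℝ F] {f : E → F} {K : ℝ} (hf : ContDiff ℝ 2 f)
    (hK : ∀ x, ‖iteratedFDeriv ℝ 2 f x‖ ≤ K) (x y : E) :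
    ‖f y - f x - fderiv ℝ f x (y - x)‖ ≤ K * ‖y - x‖ ^ 2 := by
  have hK0 : 0 ≤ K := (norm_nonneg _).trans (hK x)
  rw [pow_two, ← mul_assoc]
  refine (convex_closedBall x ‖y - x‖).norm_image_sub_le_of_norm_fderiv_le' (𝕜 := ℝ)
    (fun z _ => hf.differentiable (by norm_num) z) (fun z hz => ?_)
    (Metric.mem_closedBall_self (norm_nonneg _)) (by simp [dist_eq_norm])
  refine (norm_fderiv_sub_le_of_norm_iteratedFDeriv_two_le hf hK x z).trans ?_
  rw [Metric.mem_closedBall, dist_eq_norm] at hz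
  gcongr

/-- Demodulation estimate for a single output `f`: if `x = a + (ε s) g(a) + e` with
`‖e‖ ≤ M ε²`, then `f x - ε L_g f(x) s` agrees with `f a` up to `O(ε²)`. -/
theorem abs_sub_lieDeriv_sub_le
    {E : Type*} [NormedAddCommGroup E] [NormedSpace ℝ E] {g : E → E} {f : E → ℝ}
    {K B m M s ε : ℝ} (hf : ContDiff ℝ 2 f)
    (hf1 : ∀ x, ‖iteratedFDeriv ℝ 1 f x‖ ≤ K) (hf2 : ∀ x, ‖iteratedFDeriv ℝ 2 f x‖ ≤ K)
    (hg : Differentiable ℝ g) (hg0 : ∀ x, ‖g x‖ ≤ B)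
    (hg1 : ∀ x, ‖iteratedFDeriv ℝ 1 g x‖ ≤ B)
    (hs : |s| ≤ m) (hM : 0 ≤ M) (hε : 0 < ε) (hε1 : ε ≤ 1) {a e : E} (he : ‖e‖ ≤ M * ε ^ 2) :
    |f (a + (ε * s) • g a + e)
        - ε * fderiv ℝ f (a + (ε * s) • g a + e) (g (a + (ε * s) • g a + e)) * s - f a|
      ≤ (K * (m * B + M) ^ 2 + K * (m * (B * (m * B + M)) + M)) * ε ^ 2 := by
  set x := a + (ε * s) • g a + e with hx
  have hK : 0 ≤ K := (norm_nonneg _).trans (hf1 a)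
  have hB : 0 ≤ B := (norm_nonneg _).trans (hg0 a)
  have hm : 0 ≤ m := (abs_nonneg _).trans hs
  have hax : a - x = -((ε * s) • g a + e) := by rw [hx]; abel
  have hεs : ‖ε * s‖ ≤ ε * m := by
    rw [norm_mul, Real.norm_of_nonneg hε.le, Real.norm_eq_abs]
    gcongr
  have hd : ‖a - x‖ ≤ (m * B + M) * ε := by
    rw [hax, norm_neg]
    calc ‖(ε * s) • g a + e‖ ≤ ‖ε * s‖ * ‖g a‖ + ‖e‖ :=
          (norm_add_le _ _).trans_eq (by rw [norm_smul])
      _ ≤ ε * m * B + M * (ε * 1) := by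
          refine add_le_add (mul_le_mul hεs (hg0 a) (norm_nonneg _) (by positivity))
            (he.trans ?_)
          rw [pow_two]
          gcongr
      _ = (m * B + M) * ε := by ring
  have hgd : ‖g x - g a‖ ≤ B * ((m * B + M) * ε) := by
    rw [norm_sub_rev]
    refine (convex_univ.norm_image_sub_le_of_norm_fderiv_le (𝕜 := ℝ) (fun z _ => hg z)
      (fun z _ => ?_) (Set.mem_univ x) (Set.mem_univ a)).trans (by gcongr)
    rw [← norm_iteratedFDeriv_one]
    exact hg1 z
  have key : f x - ε * fderiv ℝ f x (g x) * s - f a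
      = -(f a - f x - fderiv ℝ f x (a - x)) - fderiv ℝ f x ((ε * s) • (g x - g a) - e) := by
    rw [hax]
    simp only [map_neg, map_add, map_sub, map_smul, smul_eq_mul]
    ring
  rw [key, ← Real.norm_eq_abs]
  refine (norm_sub_le _ _).trans ?_
  rw [norm_neg, add_mul]
  refine add_le_add ?_ ?_
  · calc _ ≤ K * ‖a - x‖ ^ 2 := norm_sub_sub_fderiv_apply_le hf hf2 x a
      _ ≤ K * ((m * B + M) * ε) ^ 2 := by gcongr
      _ = _ := by ring
  · have hfx : ‖fderiv ℝ f x‖ ≤ K := by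
      rw [← norm_iteratedFDeriv_one]
      exact hf1 x
    calc _ ≤ K * ‖(ε * s) • (g x - g a) - e‖ := (fderiv ℝ f x).le_of_opNorm_le hfx _
      _ ≤ K * (ε * m * (B * ((m * B + M) * ε)) + M * ε ^ 2) := by
          gcongr
          refine (norm_sub_le _ _).trans (add_le_add ?_ he)
          rw [norm_smul]
          gcongr
      _ = _ := by ring

/-- The Lie derivative of `h` along `g` inherits derivative bounds from those of `g` and `h`. -/
theorem norm_iteratedFDeriv_lieDeriv_le
    {E : Type*} [NormedAddCommGroup E] [NormedSpace ℝ E] {g : E → E} {h : E → ℝ}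
    {B : ℝ} (hg : ContDiff ℝ 2 g) (hh : ContDiff ℝ 3 h)
    (hg_bdd : ∀ i : ℕ, i ≤ 2 → ∀ x, ‖iteratedFDeriv ℝ i g x‖ ≤ B)
    (hh_bdd : ∀ i : ℕ, i ≤ 3 → ∀ x, ‖iteratedFDeriv ℝ i h x‖ ≤ B)
    {k : ℕ} (hk : k ≤ 2) (x : E) :
    ‖iteratedFDeriv ℝ k (fun z => fderiv ℝ h z (g z)) x‖ ≤ 4 * B ^ 2 := by
  have hB : 0 ≤ B := (norm_nonneg _).trans (hg_bdd 0 (by norm_num) x)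
  have hh' : ContDiff ℝ 2 (fderiv ℝ h) := hh.fderiv_right (by norm_num)
  refine (norm_iteratedFDeriv_clm_apply hh' hg x (by exact_mod_cast hk)).trans ?_
  calc _ ≤ ∑ i ∈ Finset.range (k + 1), (k.choose i : ℝ) * B * B := by
        refine Finset.sum_le_sum fun i hi => ?_
        have hi' : i ≤ k := Nat.lt_succ_iff.mp (Finset.mem_range.mp hi)
        rw [norm_iteratedFDeriv_fderiv]
        exact mul_le_mul
          (mul_le_mul_of_nonneg_left (hh_bdd (i + 1) (by omega) x) (Nat.cast_nonneg _))
          (hg_bdd (k - i) (by omega) x) (norm_nonneg _) (by positivity)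
    _ = 2 ^ k * B ^ 2 := by
        simp_rw [mul_assoc, ← pow_two]
        rw [← Finset.sum_mul, ← Nat.cast_sum, Nat.sum_range_choose, Nat.cast_pow, Nat.cast_ofNat]
    _ ≤ 2 ^ 2 * B ^ 2 := by gcongr; norm_num
    _ = 4 * B ^ 2 := by norm_num

/-- Demodulated signals recover the averaged outputs up to O(ε²).
For `x = x̄ + ε g(x̄) S(σ) + e` with `‖e‖ ≤ M ε²`, one has
`|h(x) − ε L_g h(x) S(σ) − h(x̄)| ≤ C ε²` and
`|L_g h(x) − ε L_g² h(x) S(σ) − L_g h(x̄)| ≤ C ε²`. -/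
theorem virtual_output_demodulation_accuracy
    (n : ℕ)
    (g : EuclideanSpace ℝ (Fin n) → EuclideanSpace ℝ (Fin n))
    (h : EuclideanSpace ℝ (Fin n) → ℝ)
    (S : ℝ → ℝ) (MS M B : ℝ)
    (hg : ContDiff ℝ 2 g) (hh : ContDiff ℝ 3 h)
    (hg_bdd : ∀ i : ℕ, i ≤ 2 → ∀ x, ‖iteratedFDeriv ℝ i g x‖ ≤ B)
    (hh_bdd : ∀ i : ℕ, i ≤ 3 → ∀ x, ‖iteratedFDeriv ℝ i h x‖ ≤ B)
    (hS_bdd : ∀ σ : ℝ, |S σ| ≤ MS)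
    (hM : 0 < M) :
    ∃ C : ℝ, 0 < C ∧
      ∀ (xbar : EuclideanSpace ℝ (Fin n)) (σ ε : ℝ) (e : EuclideanSpace ℝ (Fin n)),
        0 < ε → ε ≤ 1 → ‖e‖ ≤ M * ε ^ 2 →
        (fun Lgh : EuclideanSpace ℝ (Fin n) → ℝ =>
          (fun Lg2h : EuclideanSpace ℝ (Fin n) → ℝ =>
            (fun x : EuclideanSpace ℝ (Fin n) =>
              |h x - ε * Lgh x * S σ - h xbar| ≤ C * ε ^ 2 ∧
              |Lgh x - ε * Lg2h x * S σ - Lgh xbar| ≤ C * ε ^ 2)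
              (xbar + (ε * S σ) • g xbar + e))
            (fun z => fderiv ℝ Lgh z (g z)))
          (fun z => fderiv ℝ h z (g z)) := by
  have hg0 : ∀ x, ‖g x‖ ≤ B := fun x => by
    simpa using hg_bdd 0 (by norm_num) x
  have hgd : Differentiable ℝ g := hg.differentiable (by norm_num)
  have hL : ContDiff ℝ 2 fun z => fderiv ℝ h z (g z) :=
    (hh.fderiv_right (m := 2) (by norm_num)).clm_apply hg
  refine ⟨max 1 (max (B * (MS * B + M) ^ 2 + B * (MS * (B * (MS * B + M)) + M))
    (4 * B ^ 2 * (MS * B + M) ^ 2 + 4 * B ^ 2 * (MS * (B * (MS * B + M)) + M))),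
    lt_max_of_lt_left one_pos, fun xbar σ ε e hε hε1 he => ⟨?_, ?_⟩⟩
  · refine (abs_sub_lieDeriv_sub_le (hh.of_le (by norm_num)) (hh_bdd 1 (by norm_num))
      (hh_bdd 2 (by norm_num)) hgd hg0 (hg_bdd 1 (by norm_num)) (hS_bdd σ) hM.le hε hε1
      he).trans ?_
    gcongr
    exact (le_max_left _ _).trans (le_max_right _ _)
  · refine (abs_sub_lieDeriv_sub_le hL
      (norm_iteratedFDeriv_lieDeriv_le hg hh hg_bdd hh_bdd (by norm_num))
      (norm_iteratedFDeriv_lieDeriv_le hg hh hg_bdd hh_bdd le_rfl)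
      hgd hg0 (hg_bdd 1 (by norm_num)) (hS_bdd σ) hM.le hε hε1 he).trans ?_
    gcongr
    exact (le_max_right _ _).trans (le_max_right _ _)
end

section
/- Let s : ℝ → ℝ be a continuous 1-periodic function with zero mean, S its zero-mean primitive, and suppose |s| ≤ M_s and |S| ≤ M_S. Let ȳ : ℝ → ℝ be C² with |ȳ'| ≤ M₁ and |ȳ''| ≤ M₂ on ℝ, and let ȳ_v : ℝ → ℝ be C¹ with |ȳ_v| ≤ M and |ȳ_v'| ≤ M on ℝ. For ε > 0 define y(τ) := ȳ(τ) + ε ȳ_v(τ) s(τ/ε), and the sliding-average estimator ŷ̄(t) := (1/(nε)) ∫_{t−nε}^{t} y(τ) dτ. Then there exists a constant C > 0, depending only on M₁, M₂, M, M_s, M_S, such that for every integer n ≥ 1, every ε ∈ (0,1], and every t ∈ ℝ: |ŷ̄(t) − ȳ(t − nε/2)| ≤ C n² ε². -/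
/-- If the second derivative of `f` is bounded by `K`, the first-order Taylor remainder of `f`
is at most `K * (b - a) ^ 2` on `[a, b]`. -/
theorem abs_taylor_remainder_le {f : ℝ → ℝ} {K a b m x : ℝ} (hf : ContDiff ℝ 2 f)
    (hK : ∀ x, |deriv (deriv f) x| ≤ K) (hm : m ∈ Set.Icc a b) (hx : x ∈ Set.Icc a b) :
    |f x - f m - deriv f m * (x - m)| ≤ K * (b - a) ^ 2 := by
  have hK0 : 0 ≤ K := (abs_nonneg _).trans (hK 0)
  have hd : Differentiable ℝ f := hf.differentiable (by norm_num)
  have hdd : Differentiable ℝ (deriv f) :=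
    ((contDiff_succ_iff_deriv (n := 1)).1 hf).2.2.differentiable (by norm_num)
  have dist_le {u v : ℝ} (hu : u ∈ Set.Icc a b) (hv : v ∈ Set.Icc a b) : |u - v| ≤ b - a :=
    abs_le.2 ⟨by linarith [hu.1, hv.2], by linarith [hu.2, hv.1]⟩
  have hab : 0 ≤ b - a := (abs_nonneg _).trans (dist_le hm hx)
  have hderiv (z : ℝ) (hz : z ∈ Set.Icc a b) : |deriv f z - deriv f m| ≤ K * (b - a) :=
    (Convex.norm_image_sub_le_of_norm_deriv_le (fun y _ => hdd y) (fun y _ => hK y)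
      convex_univ (Set.mem_univ m) (Set.mem_univ z)).trans
      (mul_le_mul_of_nonneg_left (dist_le hz hm) hK0)
  have key := Convex.norm_image_sub_le_of_norm_hasDerivWithin_le
    (f := fun y => f y - deriv f m * y) (f' := fun y => deriv f y - deriv f m)
    (fun z _ => by
      simpa using ((hd z).hasDerivAt.fun_sub
        ((hasDerivAt_id z).const_mul (deriv f m))).hasDerivWithinAt)
    hderiv (convex_Icc a b) hm hx
  have hrw : f x - f m - deriv f m * (x - m)
      = f x - deriv f m * x - (f m - deriv f m * m) := by ring
  rw [hrw]
  calc _ ≤ K * (b - a) * |x - m| := key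
    _ ≤ K * (b - a) * (b - a) := mul_le_mul_of_nonneg_left (dist_le hx hm) (by positivity)
    _ = K * (b - a) ^ 2 := by ring

/-- A zero-mean `1`-periodic function, rescaled to period `ε`, integrates to zero over
`n` periods. -/
theorem integral_comp_div_eq_zero_of_periodic {s : ℝ → ℝ} (hs : Continuous s)
    (hp : Function.Periodic s 1)
    (h0 : (∫ σ in (0:ℝ)..1, s σ) = 0) (n : ℕ) {ε : ℝ} (hε : 0 < ε) (t : ℝ) :
    (∫ τ in (t - n * ε)..t, s (τ / ε)) = 0 := by
  rw [intervalIntegral.integral_comp_div _ hε.ne']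
  have h := hp.intervalIntegral_add_zsmul_eq (n : ℤ) ((t - n * ε) / ε)
    fun _ _ => hs.intervalIntegrable _ _
  rw [hp.intervalIntegral_add_eq ((t - n * ε) / ε) 0, zero_add, h0, smul_zero] at h
  have e : (t - n * ε) / ε + (n : ℤ) • (1 : ℝ) = t / ε := by
    simp only [zsmul_eq_mul, Int.cast_natCast]
    field_simp
    ring
  rw [e] at h
  rw [h, smul_zero]

/-- Accuracy of the sliding-average estimator
`ŷ̄(t) = (1/(nε)) ∫_{t−nε}^t y(τ) dτ` for `y(τ) = ȳ(τ) + ε ȳ_v(τ) s(τ/ε)`: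
there is a constant `C > 0`, depending only on the bounds `M₁, M₂, M, M_s, M_S`,
such that `|ŷ̄(t) − ȳ(t − nε/2)| ≤ C n² ε²` for all `n ≥ 1`, `ε ∈ (0,1]`, `t`. -/
theorem sliding_average_estimator_accuracy (M₁ M₂ M Ms MS : ℝ) :
    ∃ C : ℝ, 0 < C ∧
      ∀ (s S ybar ybarv : ℝ → ℝ),
        Continuous s → Function.Periodic s 1 → (∫ σ in (0:ℝ)..1, s σ) = 0 →
        (∀ σ : ℝ, S σ =
          (∫ τ in (0:ℝ)..σ, s τ) - ∫ μ in (0:ℝ)..1, ∫ τ in (0:ℝ)..μ, s τ) →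
        (∀ σ : ℝ, |s σ| ≤ Ms) → (∀ σ : ℝ, |S σ| ≤ MS) →
        ContDiff ℝ 2 ybar →
        (∀ τ : ℝ, |deriv ybar τ| ≤ M₁) →
        (∀ τ : ℝ, |deriv (deriv ybar) τ| ≤ M₂) →
        ContDiff ℝ 1 ybarv →
        (∀ τ : ℝ, |ybarv τ| ≤ M) → (∀ τ : ℝ, |deriv ybarv τ| ≤ M) →
        ∀ (n : ℕ), 1 ≤ n → ∀ ε : ℝ, 0 < ε → ε ≤ 1 → ∀ t : ℝ,
          |(1 / (n * ε)) *
              (∫ τ in (t - n * ε)..t, (ybar τ + ε * ybarv τ * s (τ / ε))) -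
            ybar (t - n * ε / 2)| ≤ C * n ^ 2 * ε ^ 2 := by
  refine ⟨|M₂| + |M| * |Ms| + 1, by positivity, ?_⟩
  intro s _ f v hs hp h0 _ hMs _ hf _ hf2 hv _ hv1 n hn ε hε _ t
  have hn1 : (1 : ℝ) ≤ n := by exact_mod_cast hn
  have hT : 0 < n * ε := by positivity
  have hM0 : 0 ≤ M := (abs_nonneg _).trans (hv1 0)
  have hMs0 : 0 ≤ Ms := (abs_nonneg _).trans (hMs 0)
  have hM20 : 0 ≤ M₂ := (abs_nonneg _).trans (hf2 0)
  rw [abs_of_nonneg hM0, abs_of_nonneg hMs0, abs_of_nonneg hM20]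
  have hfc := hf.continuous
  have hvc := hv.continuous
  have hsc : Continuous fun τ => s (τ / ε) := hs.comp (continuous_id.div_const ε)
  set m := t - n * ε / 2 with hm
  set d := deriv f m
  have hbound : ∀ τ ∈ Set.uIoc (t - n * ε) t,
      ‖(f τ - f m - d * (τ - m)) + ε * ((v τ - v t) * s (τ / ε))‖
        ≤ M₂ * (n * ε) ^ 2 + ε * (M * (n * ε) * Ms) := by
    intro τ hτ
    rw [Set.uIoc_of_le (by linarith)] at hτ
    refine (norm_add_le _ _).trans (add_le_add ?_ ?_)
    · have h := abs_taylor_remainder_le (a := t - n * ε) (b := t) (m := m) (x := τ) hf hf2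
        ⟨by linarith, by linarith⟩ ⟨hτ.1.le, hτ.2⟩
      rwa [sub_sub_cancel] at h
    · have hvt : |v τ - v t| ≤ M * (n * ε) :=
        (Convex.norm_image_sub_le_of_norm_deriv_le
          (fun y _ => hv.differentiable (by norm_num) y) (fun y _ => hv1 y)
          convex_univ (Set.mem_univ t) (Set.mem_univ τ)).trans
          (mul_le_mul_of_nonneg_left
            (abs_le.2 ⟨by linarith [hτ.1], by linarith [hτ.2]⟩) hM0)
      rw [Real.norm_eq_abs, abs_mul, abs_mul, abs_of_pos hε]
      gcongr
      exact hMs _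
  have hint := intervalIntegral.norm_integral_le_of_norm_le_const hbound
  have hlin : (∫ τ in (t - n * ε)..t, d * (τ - m)) = 0 := by
    rw [intervalIntegral.integral_const_mul, intervalIntegral.integral_sub
      (continuous_id'.intervalIntegrable _ _) (continuous_const.intervalIntegrable _ _),
      integral_id, intervalIntegral.integral_const, hm, smul_eq_mul]
    ring
  have hper : (∫ τ in (t - n * ε)..t, ε * v t * s (τ / ε)) = 0 := by
    rw [intervalIntegral.integral_const_mul,
      integral_comp_div_eq_zero_of_periodic hs hp h0 n hε t, mul_zero]
  have hsplit : (∫ τ in (t - n * ε)..t,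
        ((f τ - f m - d * (τ - m)) + ε * ((v τ - v t) * s (τ / ε))))
      = (∫ τ in (t - n * ε)..t, (f τ + ε * v τ * s (τ / ε))) - n * ε * f m := by
    have hrw : (fun τ => (f τ - f m - d * (τ - m)) + ε * ((v τ - v t) * s (τ / ε)))
        = fun τ => (f τ + ε * v τ * s (τ / ε)) - f m - d * (τ - m)
          - ε * v t * s (τ / ε) := by
      ext τ
      ring
    have i1 : Continuous fun τ => f τ + ε * v τ * s (τ / ε) := by fun_prop
    have i2 : Continuous fun τ => d * (τ - m) := by fun_prop
    have i3 : Continuous fun τ => ε * v t * s (τ / ε) := by fun_prop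
    rw [hrw, intervalIntegral.integral_sub
        (Continuous.intervalIntegrable (by fun_prop) _ _) (i3.intervalIntegrable _ _),
      intervalIntegral.integral_sub
        (Continuous.intervalIntegrable (by fun_prop) _ _) (i2.intervalIntegrable _ _),
      intervalIntegral.integral_sub (i1.intervalIntegrable _ _)
        (continuous_const.intervalIntegrable _ _),
      hlin, hper, intervalIntegral.integral_const, smul_eq_mul]
    ring
  rw [hsplit, sub_sub_cancel, abs_of_pos hT, Real.norm_eq_abs] at hint
  set I := ∫ τ in (t - n * ε)..t, (f τ + ε * v τ * s (τ / ε))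
  have hdiv : 1 / (n * ε) * I - f m = (I - n * ε * f m) / (n * ε) := by
    field_simp
  rw [hdiv, abs_div, abs_of_pos hT]
  refine ((div_le_iff₀ hT).2 hint).trans ?_
  have hn2 : (n : ℝ) ≤ n ^ 2 := by nlinarith
  have h1 : M * Ms * ε ^ 2 * n ≤ M * Ms * ε ^ 2 * n ^ 2 :=
    mul_le_mul_of_nonneg_left hn2 (by positivity)
  have h2 : 0 ≤ (n : ℝ) ^ 2 * ε ^ 2 := by positivity
  linear_combination h1 + h2
end

section
/- Let s : ℝ → ℝ be a continuous 1-periodic function with zero mean and ∫₀¹ s(σ)² dσ > 0, S its zero-mean primitive, with |s| ≤ M_s and |S| ≤ M_S. Let ȳ : ℝ → ℝ be C² with first and second derivatives bounded by M, and ȳ_v : ℝ → ℝ be C² with |ȳ_v|, |ȳ_v'|, |ȳ_v''| ≤ M on ℝ. For ε > 0 define y(τ) := ȳ(τ) + ε ȳ_v(τ) s(τ/ε), ŷ̄(t) := (1/(nε)) ∫_{t−nε}^{t} y(τ) dτ, and the demodulation estimator ŷ_v(t) := (1/ε) · [ (1/(nε)) ∫_{t−nε}^{t} ( y(τ − nε/2)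 − ŷ̄(τ) ) s((τ − nε/2)/ε) dτ ] / [ (1/(nε)) ∫_{t−nε}^{t} s(τ/ε)² dτ ]. Then there exists a constant C > 0, depending only on M, M_s, M_S and ∫₀¹ s², such that for every integer n ≥ 1, every ε ∈ (0,1], and every t ∈ ℝ: |ŷ_v(t) − ȳ_v(t)| ≤ C n² ε. -/
/-- The integral of a `1`-periodic function, rescaled to period `ε`, over `n` full periods. -/
lemma integral_periodic_comp_div {f : ℝ → ℝ} (hc : Continuous f) (hf : Function.Periodic f 1)
    (n : ℕ) {ε : ℝ} (hε : ε ≠ 0) (t c : ℝ) :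
    ∫ τ in (t - n * ε)..t, f ((τ - c) / ε) = n * ε * ∫ σ in (0:ℝ)..1, f σ := by
  have h1 : ∀ τ, f ((τ - c) / ε) = f (τ / ε - c / ε) := fun τ => by rw [sub_div]
  simp_rw [h1]
  rw [intervalIntegral.integral_comp_div_sub f hε]
  have h2 := hf.intervalIntegral_add_zsmul_eq n ((t - n * ε) / ε - c / ε)
    (fun a b => hc.intervalIntegrable a b)
  have h3 : (t - n * ε) / ε - c / ε + (n : ℤ) • (1:ℝ) = t / ε - c / ε := by
    simp only [zsmul_eq_mul, Int.cast_natCast]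
    field_simp
    ring
  rw [h3, hf.intervalIntegral_add_eq _ 0] at h2
  rw [h2]
  simp only [zsmul_eq_mul, Int.cast_natCast, smul_eq_mul, zero_add]
  ring

lemma abs_sub_le_of_abs_deriv_le {f : ℝ → ℝ} {M : ℝ} (hf : Differentiable ℝ f)
    (hM : ∀ x, |deriv f x| ≤ M) (x y : ℝ) : |f y - f x| ≤ M * |y - x| :=
  Convex.norm_image_sub_le_of_norm_deriv_le (s := Set.univ) (fun z _ => hf z)
    (fun z _ => hM z) convex_univ (Set.mem_univ x) (Set.mem_univ y)

/-- First-order Taylor estimate from a bound on the second derivative. -/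
lemma abs_sub_sub_deriv_mul_le {f : ℝ → ℝ} {M : ℝ} (hf : Differentiable ℝ f)
    (hf' : Differentiable ℝ (deriv f)) (hM : ∀ x, |deriv (deriv f) x| ≤ M) (m u : ℝ) :
    |f u - f m - deriv f m * (u - m)| ≤ M * |u - m| ^ 2 := by
  have hM0 : 0 ≤ M := (abs_nonneg _).trans (hM 0)
  have hd : ∀ z, HasDerivAt (fun x => f x - deriv f m * x) (deriv f z - deriv f m) z := fun z => by
    have h := (hf z).hasDerivAt.sub ((hasDerivAt_id z).const_mul (deriv f m))
    rw [mul_one] at h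
    exact h
  have key := Convex.norm_image_sub_le_of_norm_hasDerivWithin_le (s := Set.uIcc m u)
    (C := M * |u - m|) (fun z _ => (hd z).hasDerivWithinAt)
    (fun z hz => (abs_sub_le_of_abs_deriv_le hf' hM m z).trans
      (mul_le_mul_of_nonneg_left (Set.abs_sub_left_of_mem_uIcc hz) hM0))
    (convex_uIcc m u) Set.left_mem_uIcc Set.right_mem_uIcc
  simp only [Real.norm_eq_abs] at key
  calc |f u - f m - deriv f m * (u - m)|
      = |f u - deriv f m * u - (f m - deriv f m * m)| := by congr 1; ring
    _ ≤ M * |u - m| * |u - m| := key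
    _ = M * |u - m| ^ 2 := by ring

/-- Midpoint rule. -/
lemma abs_integral_sub_midpoint_le {f : ℝ → ℝ} {M L : ℝ} (hL : 0 ≤ L) (hf : Differentiable ℝ f)
    (hf' : Differentiable ℝ (deriv f)) (hM : ∀ x, |deriv (deriv f) x| ≤ M) (u : ℝ) :
    |(∫ x in (u - L)..u, f x) - L * f (u - L / 2)| ≤ M * L ^ 2 * L := by
  have hM0 : 0 ≤ M := (abs_nonneg _).trans (hM 0)
  set m := u - L / 2 with hm
  have hb := intervalIntegral.norm_integral_le_of_norm_le_const (a := u - L) (b := u)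
    (f := fun x => f x - f m - deriv f m * (x - m)) (C := M * L ^ 2) (fun x hx => by
      rw [Set.uIoc_of_le (by linarith)] at hx
      refine (abs_sub_sub_deriv_mul_le hf hf' hM m x).trans ?_
      have : |x - m| ≤ L := abs_le.2 ⟨by linarith [hx.1], by linarith [hx.2]⟩
      gcongr)
  have hlin : ∫ x in (u - L)..u, deriv f m * (x - m) = 0 := by
    rw [intervalIntegral.integral_const_mul,
      intervalIntegral.integral_sub (by simp) (by simp), integral_id,
      intervalIntegral.integral_const, smul_eq_mul, hm]
    ring
  have hc := hf.continuous
  rw [intervalIntegral.integral_sub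
      (Continuous.intervalIntegrable (by fun_prop) _ _)
      (Continuous.intervalIntegrable (by fun_prop) _ _), hlin,
    intervalIntegral.integral_sub (hc.intervalIntegrable _ _) (by simp),
    intervalIntegral.integral_const, sub_sub_cancel, abs_of_nonneg hL] at hb
  simpa using hb

/-- Averaging a slowly varying amplitude against a zero-mean carrier over full periods. -/
lemma abs_integral_mul_carrier_le {s v : ℝ → ℝ} {M Ms : ℝ} (hs : Continuous s)
    (hper : Function.Periodic s 1) (hmean : (∫ σ in (0:ℝ)..1, s σ) = 0)
    (hMs : ∀ σ, |s σ| ≤ Ms) (hv : Differentiable ℝ v) (hM : ∀ x, |deriv v x| ≤ M)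
    (n : ℕ) {ε : ℝ} (hε : 0 < ε) (u : ℝ) :
    |∫ x in (u - n * ε)..u, v x * s (x / ε)| ≤ M * (n * ε) * Ms * (n * ε) := by
  have hM0 : 0 ≤ M := (abs_nonneg _).trans (hM 0)
  have hL : 0 ≤ n * ε := by positivity
  have hb := intervalIntegral.norm_integral_le_of_norm_le_const (a := u - n * ε) (b := u)
    (f := fun x => v x * s (x / ε) - v u * s (x / ε)) (C := M * (n * ε) * Ms) (fun x hx => by
      rw [Set.uIoc_of_le (by linarith)] at hx
      have : |x - u| ≤ n * ε := abs_le.2 ⟨by linarith [hx.1], by linarith [hx.2]⟩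
      rw [← sub_mul, norm_mul]
      exact mul_le_mul ((abs_sub_le_of_abs_deriv_le hv hM u x).trans (by gcongr)) (hMs _)
        (norm_nonneg _) (by positivity))
  have hz := integral_periodic_comp_div hs hper n hε.ne' u 0
  simp only [sub_zero, hmean, mul_zero] at hz
  have hc := hv.continuous
  rw [intervalIntegral.integral_sub
      (Continuous.intervalIntegrable (by fun_prop) _ _)
      (Continuous.intervalIntegrable (by fun_prop) _ _),
    intervalIntegral.integral_const_mul, hz, sub_sub_cancel, abs_of_nonneg hL] at hb
  simpa using hb

lemma continuous_sliding_integral {y : ℝ → ℝ} (hy : Continuous y) (L : ℝ) :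
    Continuous fun u : ℝ => ∫ τ in (u - L)..u, y τ := by
  have h : ∀ u : ℝ, ∫ τ in (u - L)..u, y τ =
      (∫ τ in (0:ℝ)..u, y τ) - ∫ τ in (0:ℝ)..(u - L), y τ := fun u =>
    (intervalIntegral.integral_interval_sub_left (hy.intervalIntegrable _ _)
      (hy.intervalIntegrable _ _)).symm
  have hF : Continuous fun u : ℝ => ∫ τ in (0:ℝ)..u, y τ :=
    intervalIntegral.continuous_primitive (fun a b => hy.intervalIntegrable a b) 0
  simp_rw [h]
  exact hF.sub (hF.comp (by fun_prop))

/-- The sliding average of the modulated signal is close to its midpoint baseline value. -/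
lemma abs_midpoint_sub_sliding_average_le {s b v : ℝ → ℝ} {M Ms : ℝ} (hs : Continuous s)
    (hper : Function.Periodic s 1) (hmean : (∫ σ in (0:ℝ)..1, s σ) = 0)
    (hMs : ∀ σ, |s σ| ≤ Ms) (hb : Differentiable ℝ b) (hb' : Differentiable ℝ (deriv b))
    (hMb : ∀ x, |deriv (deriv b) x| ≤ M) (hv : Differentiable ℝ v) (hMv : ∀ x, |deriv v x| ≤ M)
    {n : ℕ} (hn : 1 ≤ n) {ε : ℝ} (hε : 0 < ε) (u : ℝ) :
    |b (u - n * ε / 2) - 1 / (n * ε) * ∫ x in (u - n * ε)..u, (b x + ε * v x * s (x / ε))|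
      ≤ M * (n * ε) ^ 2 + ε * (M * (n * ε) * Ms) := by
  have hn0 : (0:ℝ) < n := by exact_mod_cast hn
  have hL : 0 < n * ε := by positivity
  have h1 := abs_integral_sub_midpoint_le hL.le hb hb' hMb u
  have h2 := abs_integral_mul_carrier_le hs hper hmean hMs hv hMv n hε u
  have hcb := hb.continuous
  have hcv := hv.continuous
  have hsplit : ∫ x in (u - n * ε)..u, (b x + ε * v x * s (x / ε)) =
      (∫ x in (u - n * ε)..u, b x) + ε * ∫ x in (u - n * ε)..u, v x * s (x / ε) := by
    rw [intervalIntegral.integral_add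
      (Continuous.intervalIntegrable (by fun_prop) _ _)
      (Continuous.intervalIntegrable (by fun_prop) _ _), ← intervalIntegral.integral_const_mul]
    simp only [mul_assoc]
  rw [hsplit]
  set A := ∫ x in (u - n * ε)..u, b x
  set B := ∫ x in (u - n * ε)..u, v x * s (x / ε)
  set L := n * ε
  have heq : b (u - L / 2) - 1 / L * (A + ε * B) = -((A - L * b (u - L / 2)) + ε * B) / L := by
    field_simp
    ring
  rw [heq, abs_div, abs_neg, abs_of_pos hL, div_le_iff₀ hL]
  calc |A - L * b (u - L / 2) + ε * B| ≤ |A - L * b (u - L / 2)| + |ε * B| := abs_add_le _ _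
    _ = |A - L * b (u - L / 2)| + ε * |B| := by rw [abs_mul, abs_of_pos hε]
    _ ≤ M * L ^ 2 * L + ε * (M * L * Ms * L) := by gcongr
    _ = _ := by ring


/-- Accuracy of the demodulation estimator: for
`y(τ) = ȳ(τ) + ε ȳ_v(τ) s(τ/ε)`, `ŷ̄(t) = (1/(nε)) ∫_{t−nε}^t y`, and
`ŷ_v(t) = (1/ε) · [(1/(nε)) ∫_{t−nε}^t (y(τ − nε/2) − ŷ̄(τ)) s((τ − nε/2)/ε) dτ]
            / [(1/(nε)) ∫_{t−nε}^t s(τ/ε)² dτ]`,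
there is `C > 0` depending only on `M, M_s, M_S, ∫₀¹ s²` such that
`|ŷ_v(t) − ȳ_v(t)| ≤ C n² ε` for all `n ≥ 1`, `ε ∈ (0,1]`, `t`. -/
theorem demodulation_estimator_accuracy (M Ms MS I : ℝ) :
    ∃ C : ℝ, 0 < C ∧
      ∀ (s S ybar ybarv : ℝ → ℝ),
        Continuous s → Function.Periodic s 1 → (∫ σ in (0:ℝ)..1, s σ) = 0 →
        (∫ σ in (0:ℝ)..1, (s σ) ^ 2) = I → 0 < I →
        (∀ σ : ℝ, S σ =
          (∫ τ in (0:ℝ)..σ, s τ) - ∫ μ in (0:ℝ)..1, ∫ τ in (0:ℝ)..μ, s τ) →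
        (∀ σ : ℝ, |s σ| ≤ Ms) → (∀ σ : ℝ, |S σ| ≤ MS) →
        ContDiff ℝ 2 ybar →
        (∀ τ : ℝ, |deriv ybar τ| ≤ M) →
        (∀ τ : ℝ, |deriv (deriv ybar) τ| ≤ M) →
        ContDiff ℝ 2 ybarv →
        (∀ τ : ℝ, |ybarv τ| ≤ M) → (∀ τ : ℝ, |deriv ybarv τ| ≤ M) →
        (∀ τ : ℝ, |deriv (deriv ybarv) τ| ≤ M) →
        ∀ (n : ℕ), 1 ≤ n → ∀ ε : ℝ, 0 < ε → ε ≤ 1 → ∀ t : ℝ,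
          -- the signal, the sliding average, and the demodulation estimator
          (fun y : ℝ → ℝ =>
            (fun ybarhat : ℝ → ℝ =>
              |(1 / ε) *
                  (((1 / (n * ε)) *
                      ∫ τ in (t - n * ε)..t,
                        (y (τ - n * ε / 2) - ybarhat τ) * s ((τ - n * ε / 2) / ε)) /
                    ((1 / (n * ε)) * ∫ τ in (t - n * ε)..t, (s (τ / ε)) ^ 2)) -
                ybarv t| ≤ C * n ^ 2 * ε)
              (fun u : ℝ => (1 / (n * ε)) * ∫ τ in (u - n * ε)..u, y τ))
            (fun τ : ℝ => ybar τ + ε * ybarv τ * s (τ / ε)) := by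
  refine ⟨1 + (|M| * |Ms| + 3 * |M| * Ms ^ 2) / |I|, by positivity, ?_⟩
  intro s S ybar ybarv hs hper hmean hI hI0 _ hMs _ hb _ hMb hv _ hMv _ n hn ε hε _ t
  have hM0 : 0 ≤ M := (abs_nonneg _).trans (hMb 0)
  have hMs0 : 0 ≤ Ms := (abs_nonneg _).trans (hMs 0)
  rw [abs_of_nonneg hM0, abs_of_nonneg hMs0, abs_of_pos hI0]
  have hn1 : (1:ℝ) ≤ n := by exact_mod_cast hn
  have hL : 0 < n * ε := by positivity
  have hbd : Differentiable ℝ ybar := hb.differentiable (by norm_num)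
  have hbd' : Differentiable ℝ (deriv ybar) := hb.differentiable_deriv_two
  have hvd : Differentiable ℝ ybarv := hv.differentiable (by norm_num)
  have hcb := hbd.continuous
  have hcv := hvd.continuous
  have hcs2 : Continuous fun σ => s σ ^ 2 := by fun_prop
  have hper2 : Function.Periodic (fun σ => s σ ^ 2) 1 := fun σ => by
    change s (σ + 1) ^ 2 = s σ ^ 2
    rw [hper σ]
  have hsq : ∀ c : ℝ, ∫ τ in (t - n * ε)..t, s ((τ - c) / ε) ^ 2 = n * ε * I := fun c => by
    rw [← hI]
    exact integral_periodic_comp_div hcs2 hper2 n hε.ne' t c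
  have hden := hsq 0
  simp only [sub_zero] at hden
  beta_reduce
  rw [hden]
  set yhat : ℝ → ℝ := fun u =>
    1 / (n * ε) * ∫ x in (u - n * ε)..u, (ybar x + ε * ybarv x * s (x / ε)) with hyhat
  have hcy : Continuous yhat :=
    continuous_const.mul (continuous_sliding_integral (by fun_prop) _)
  set F : ℝ → ℝ := fun τ =>
    (ybar (τ - n * ε / 2) + ε * ybarv (τ - n * ε / 2) * s ((τ - n * ε / 2) / ε) - yhat τ) *
      s ((τ - n * ε / 2) / ε) with hF
  have hcF : Continuous F := by fun_prop
  set K : ℝ := M * Ms * (n * ε) ^ 2 + 3 * M * Ms ^ 2 * (n * ε) * ε with hK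
  have hpt : ∀ τ ∈ Set.uIoc (t - n * ε) t,
      ‖F τ - ε * ybarv t * s ((τ - n * ε / 2) / ε) ^ 2‖ ≤ K := fun τ hτ => by
    rw [Set.uIoc_of_le (by linarith)] at hτ
    have h1 := abs_midpoint_sub_sliding_average_le hs hper hmean hMs hbd hbd' hMb hvd hMv hn hε τ
    have h2 : |ybarv (τ - n * ε / 2) - ybarv t| ≤ M * (2 * (n * ε)) :=
      (abs_sub_le_of_abs_deriv_le hvd hMv _ _).trans (by
        gcongr
        exact abs_le.2 ⟨by linarith [hτ.1], by linarith [hτ.2]⟩)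
    have h3 := hMs ((τ - n * ε / 2) / ε)
    change |ybar (τ - n * ε / 2) - yhat τ| ≤ _ at h1
    set σ := s ((τ - n * ε / 2) / ε)
    have heq : F τ - ε * ybarv t * σ ^ 2 = ((ybar (τ - n * ε / 2) - yhat τ) +
        ε * ((ybarv (τ - n * ε / 2) - ybarv t) * σ)) * σ := by
      simp only [hF]
      ring
    rw [heq, Real.norm_eq_abs, abs_mul]
    calc _ ≤ (|ybar (τ - n * ε / 2) - yhat τ| +
          ε * (|ybarv (τ - n * ε / 2) - ybarv t| * |σ|)) * |σ| := by
          gcongr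
          refine (abs_add_le _ _).trans_eq ?_
          rw [abs_mul, abs_mul, abs_of_pos hε]
      _ ≤ ((M * (n * ε) ^ 2 + ε * (M * (n * ε) * Ms)) +
          ε * (M * (2 * (n * ε)) * Ms)) * Ms := by gcongr
      _ = K := by rw [hK]; ring
  have hint := intervalIntegral.norm_integral_le_of_norm_le_const hpt
  rw [intervalIntegral.integral_sub (hcF.intervalIntegrable _ _)
      (Continuous.intervalIntegrable (by fun_prop) _ _), intervalIntegral.integral_const_mul,
    hsq, sub_sub_cancel, abs_of_pos hL, Real.norm_eq_abs] at hint
  set X := ∫ τ in (t - n * ε)..t, F τ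
  have hfin : 1 / ε * (1 / (n * ε) * X / (1 / (n * ε) * (n * ε * I))) - ybarv t =
      (X - ε * ybarv t * (n * ε * I)) / (ε * (n * ε) * I) := by
    field_simp
  rw [hfin, abs_div, abs_of_pos (by positivity : 0 < ε * (n * ε) * I),
    div_le_iff₀ (by positivity)]
  refine hint.trans ?_
  have hnn : (n:ℝ) ≤ n ^ 2 := by nlinarith
  have hKle : K ≤ (M * Ms + 3 * M * Ms ^ 2) * n ^ 2 * ε ^ 2 := by
    calc K = M * Ms * n ^ 2 * ε ^ 2 + 3 * M * Ms ^ 2 * n * ε ^ 2 := by rw [hK]; ring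
      _ ≤ M * Ms * n ^ 2 * ε ^ 2 + 3 * M * Ms ^ 2 * n ^ 2 * ε ^ 2 := by gcongr
      _ = _ := by ring
  calc K * (n * ε) ≤ ((M * Ms + 3 * M * Ms ^ 2) * n ^ 2 * ε ^ 2) * (n * ε) := by gcongr
    _ = ((M * Ms + 3 * M * Ms ^ 2) / I) * n ^ 2 * ε * (ε * (n * ε) * I) := by field_simp
    _ ≤ (1 + (M * Ms + 3 * M * Ms ^ 2) / I) * n ^ 2 * ε * (ε * (n * ε) * I) := by
      gcongr
      linarith
end

section
/- Let s : ℝ → ℝ be a continuous 1-periodic function with zero mean, S its zero-mean primitive with |S| ≤ M_S. Let ε > 0, let n ≥ 1 be an integer, let t ∈ ℝ, and let v : ℝ → ℝ be C¹ with |v'| ≤ M on the interval [t − nε, t]. Then |(1/(nε)) ∫_{t−nε}^{t} v(τ) s(τ/ε) dτ| ≤ 2 ε M M_S. (Averaging a slowly varying function against a fast zero-mean oscillation over an integer number of periods gives a contribution of order ε.) -/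
/-- The primitive of a continuous 1-periodic function with zero mean is 1-periodic. -/
lemma Function.Periodic.intervalIntegral_of_mean_zero {s : ℝ → ℝ}
    (hs_per : Function.Periodic s 1) (hs_cont : Continuous s)
    (hs_mean : (∫ σ in (0:ℝ)..1, s σ) = 0) :
    Function.Periodic (fun σ => ∫ τ in (0:ℝ)..σ, s τ) 1 := by
  intro σ
  have h := hs_per.intervalIntegral_add_eq σ 0
  rw [zero_add, hs_mean] at h
  have hadj := intervalIntegral.integral_add_adjacent_intervals
    (hs_cont.intervalIntegrable (μ := MeasureTheory.volume) 0 σ)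
    (hs_cont.intervalIntegrable σ (σ + 1))
  simpa [h] using hadj.symm

/-- Averaging a slowly varying C¹ function against a fast zero-mean
1-periodic oscillation over an integer number of periods gives a contribution of
order ε: |(1/(nε)) ∫_{t−nε}^{t} v(τ) s(τ/ε) dτ| ≤ 2 ε M M_S. -/
theorem sliding_average_against_fast_oscillation
    (s S v v' : ℝ → ℝ) (M MS : ℝ)
    (hs_cont : Continuous s) (hs_per : Function.Periodic s 1)
    (hs_mean : (∫ σ in (0:ℝ)..1, s σ) = 0)
    (hS : ∀ σ : ℝ, S σ =
      (∫ τ in (0:ℝ)..σ, s τ) - ∫ μ in (0:ℝ)..1, ∫ τ in (0:ℝ)..μ, s τ)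
    (hS_bdd : ∀ σ : ℝ, |S σ| ≤ MS)
    (ε : ℝ) (hε : 0 < ε) (n : ℕ) (hn : 1 ≤ n) (t : ℝ)
    (hv : ∀ τ ∈ Set.Icc (t - n * ε) t, HasDerivAt v (v' τ) τ)
    (hv'_cont : ContinuousOn v' (Set.Icc (t - n * ε) t))
    (hv'_bdd : ∀ τ ∈ Set.Icc (t - n * ε) t, |v' τ| ≤ M) :
    |(1 / (n * ε)) * ∫ τ in (t - n * ε)..t, v τ * s (τ / ε)| ≤ 2 * ε * M * MS := by
  have hS_deriv : ∀ σ, HasDerivAt S (s σ) σ := by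
    rw [funext hS]
    intro σ
    exact (hs_cont.integral_hasStrictDerivAt 0 σ).hasDerivAt.sub_const _
  have hS_per : Function.Periodic S 1 := by
    rw [funext hS]
    exact (hs_per.intervalIntegral_of_mean_zero hs_cont hs_mean).comp
      (fun x => x - ∫ μ in (0:ℝ)..1, ∫ τ in (0:ℝ)..μ, s τ)
  have hn' : (0:ℝ) < n := by exact_mod_cast hn
  have hL : (0:ℝ) < n * ε := by positivity
  have hle : t - n * ε ≤ t := by linarith
  have hends : S ((t - n * ε) / ε) = S (t / ε) := by
    have h : (t - n * ε) / ε = t / ε - n * 1 := by field_simp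
    rw [h, hS_per.sub_nat_mul_eq]
  have hw : ∀ τ, HasDerivAt (fun τ => ε * (S (τ / ε) - S (t / ε))) (s (τ / ε)) τ := by
    intro τ
    have h := (((hS_deriv (τ / ε)).comp τ ((hasDerivAt_id τ).div_const ε)).sub_const
      (S (t / ε))).const_mul ε
    refine h.congr_deriv ?_
    field_simp
  have hparts := intervalIntegral.integral_mul_deriv_eq_deriv_mul
    (a := t - n * ε) (b := t) (u := v) (u' := v')
    (fun τ hτ => hv τ (by rwa [Set.uIcc_of_le hle] at hτ)) (fun τ _ => hw τ)
    (hv'_cont.intervalIntegrable_of_Icc hle)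
    ((hs_cont.comp (continuous_id.div_const ε)).intervalIntegrable _ _)
  simp only [hends, sub_self, mul_zero, zero_sub] at hparts
  have hbound : ‖∫ τ in (t - n * ε)..t, v' τ * (ε * (S (τ / ε) - S (t / ε)))‖
      ≤ 2 * ε * M * MS * |t - (t - n * ε)| := by
    refine intervalIntegral.norm_integral_le_of_norm_le_const fun τ hτ => ?_
    rw [Set.uIoc_of_le hle] at hτ
    have hv'τ := hv'_bdd τ (Set.Ioc_subset_Icc_self hτ)
    have hM : 0 ≤ M := (abs_nonneg _).trans hv'τ
    have hdiff : |S (τ / ε) - S (t / ε)| ≤ MS + MS :=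
      (abs_sub _ _).trans (add_le_add (hS_bdd _) (hS_bdd _))
    rw [Real.norm_eq_abs, abs_mul, abs_mul, abs_of_pos hε]
    calc |v' τ| * (ε * |S (τ / ε) - S (t / ε)|) ≤ M * (ε * (MS + MS)) := by gcongr
      _ = 2 * ε * M * MS := by ring
  rw [sub_sub_cancel, abs_of_pos hL, Real.norm_eq_abs] at hbound
  rw [hparts, abs_mul, abs_neg, abs_of_pos (one_div_pos.mpr hL), one_div_mul_eq_div,
    div_le_iff₀ hL]
  exact hbound
end

section
/- (First-order averaging on an infinite time interval.) Consider the systems ẋ = ε F₁(x, t) and ż = ε G₁(z), where F₁ : ℝⁿ × ℝ → ℝⁿ is C², bounded with bounded derivatives, T-periodic in t, and G₁(z) := (1/T)∫₀ᵀ F₁(z, τ) dτ. Suppose the origin is an exponentially stable equilibrium of ż = G₁(z). Then there exist a compact neighborhood V of the origin, ε₀ > 0, and C > 0 such that for every z₀ ∈ V and every ε ∈ (0, ε₀): the solution z(t) of ż = ε G₁(z) with z(t₀) = z₀ and the solution x(t) of ẋ = ε F₁(x, t) with x(t₀) = z₀ both exist on [t₀, +∞), and sup_{t ∈ [t₀,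 +∞)} ‖x(t) − z(t)‖ < C ε. -/
open Set Filter Topology Metric
open scoped NNReal

/-- Global existence for bounded, globally Lipschitz vector fields. -/
theorem exists_forall_hasDerivAt_of_lipschitzWith {E : Type*} [NormedAddCommGroup E]
    [NormedSpace ℝ E] [CompleteSpace E] {f : ℝ → E → E} {K : ℝ≥0} {B : ℝ}
    (hlip : ∀ t, LipschitzWith K (f t)) (hcont : ∀ x, Continuous fun t => f t x)
    (hbdd : ∀ t x, ‖f t x‖ ≤ B) (t₀ : ℝ) (x₀ : E) :
    ∃ x : ℝ → E, x t₀ = x₀ ∧ ∀ t, HasDerivAt x (f t (x t)) t := by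
  have hB : 0 ≤ B := (norm_nonneg _).trans (hbdd 0 0)
  have hloc : ∀ N : ℕ, ∃ α : ℝ → E, α t₀ = x₀ ∧
      ∀ t ∈ Ioo (t₀ - (N + 1)) (t₀ + (N + 1)), HasDerivAt α (f t (α t)) t := by
    intro N
    have ht₀ : t₀ ∈ Icc (t₀ - (N + 1)) (t₀ + (N + 1)) := by constructor <;> linarith
    have hPL : IsPicardLindelof f (tmin := t₀ - (N + 1)) (tmax := t₀ + (N + 1)) ⟨t₀, ht₀⟩ x₀
        (B.toNNReal * (N + 1)) 0 B.toNNReal K :=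
      { lipschitzOnWith := fun t _ => (hlip t).lipschitzOnWith
        continuousOn := fun x _ => (hcont x).continuousOn
        norm_le := fun t _ x _ => by simpa [hB] using hbdd t x
        mul_max_le := by simp }
    obtain ⟨α, hα₀, hα⟩ := hPL.exists_eq_forall_mem_Icc_hasDerivWithinAt₀
    exact ⟨α, hα₀, fun t ht =>
      (hα t (Ioo_subset_Icc_self ht)).hasDerivAt (Icc_mem_nhds ht.1 ht.2)⟩
  choose α hα₀ hα using hloc
  have hagree : ∀ M N : ℕ, ∀ t, |t - t₀| < M + 1 → |t - t₀| < N + 1 → α M t = α N t := by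
    intro M N t hM hN
    have hmin : |t - t₀| < (min M N : ℕ) + 1 := by
      rcases min_choice M N with h | h <;> rw [h] <;> assumption
    have hMm : ((min M N : ℕ) : ℝ) ≤ M := by exact_mod_cast min_le_left M N
    have hNm : ((min M N : ℕ) : ℝ) ≤ N := by exact_mod_cast min_le_right M N
    have hpos : (0 : ℝ) ≤ (min M N : ℕ) := Nat.cast_nonneg _
    rw [abs_lt] at hmin
    refine ODE_solution_unique_of_mem_Ioo (s := fun _ => univ) (v := f) (K := K) (t₀ := t₀)
      (a := t₀ - ((min M N : ℕ) + 1)) (b := t₀ + ((min M N : ℕ) + 1))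
      (fun t _ => (hlip t).lipschitzOnWith) ?_ ?_ ?_ ((hα₀ M).trans (hα₀ N).symm) ?_
    · constructor <;> linarith
    · exact fun s hs => ⟨hα M s ⟨by linarith [hs.1], by linarith [hs.2]⟩, mem_univ _⟩
    · exact fun s hs => ⟨hα N s ⟨by linarith [hs.1], by linarith [hs.2]⟩, mem_univ _⟩
    · constructor <;> linarith
  have hlt : ∀ t, |t - t₀| < (⌈|t - t₀|⌉₊ : ℝ) + 1 := fun t =>
    (Nat.le_ceil _).trans_lt (lt_add_one _)
  refine ⟨fun t => α ⌈|t - t₀|⌉₊ t, hα₀ _, fun t => ?_⟩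
  have ht := abs_lt.1 (hlt t)
  refine (hα ⌈|t - t₀|⌉₊ t ⟨by linarith, by linarith⟩).congr_of_eventuallyEq ?_
  have hopen : IsOpen {s : ℝ | |s - t₀| < (⌈|t - t₀|⌉₊ : ℝ) + 1} :=
    isOpen_lt (by fun_prop) continuous_const
  filter_upwards [hopen.mem_nhds (hlt t)] with s hs
  exact hagree _ _ s (hlt s) hs

theorem norm_le_of_norm_add_sub_le {E : Type*} [SeminormedAddCommGroup E] {g : ℝ → E}
    {s T c D : ℝ} (hT : 0 < T) (hc : ∀ t ≥ s, ‖g (t + T) - g t‖ ≤ c)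
    (hD : ∀ t ∈ Icc s (s + T), ‖g t‖ ≤ D) {t : ℝ} (ht : s ≤ t) :
    ‖g t‖ ≤ c * ((t - s) / T) + D := by
  have hc₀ : 0 ≤ c := (norm_nonneg _).trans (hc s le_rfl)
  have key : ∀ k : ℕ, ∀ u ∈ Icc s (s + T), ‖g (u + k * T)‖ ≤ c * k + D := by
    intro k u hu
    induction k with
    | zero => simpa using hD u hu
    | succ k ih =>
      have h := hc (u + k * T) (by
        have : 0 ≤ k * T := by positivity
        linarith [hu.1])
      have h2 := norm_le_norm_add_norm_sub (g (u + k * T)) (g (u + k * T + T))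
      push_cast
      rw [show u + ((k : ℝ) + 1) * T = u + k * T + T by ring]
      rw [norm_sub_rev] at h2
      linarith
  have hq : 0 ≤ (t - s) / T := div_nonneg (by linarith) hT.le
  have h1 := Nat.floor_le hq
  have h2 := Nat.lt_floor_add_one ((t - s) / T)
  rw [le_div_iff₀ hT] at h1
  rw [div_lt_iff₀ hT] at h2
  have h := key ⌊(t - s) / T⌋₊ (t - ⌊(t - s) / T⌋₊ * T) ⟨by linarith, by linarith⟩
  rw [sub_add_cancel] at h
  have := mul_le_mul_of_nonneg_left (Nat.floor_le hq) hc₀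
  linarith

/-- `G` is the average over one period of the bounded, `T`-periodic field `F`, which is Lipschitz
in its first argument. -/
structure IsAverage {E : Type*} [NormedAddCommGroup E] [NormedSpace ℝ E]
    (F : E → ℝ → E) (G : E → E) (T B L : ℝ) : Prop where
  period_pos : 0 < T
  lipschitz_pos : 0 < L
  continuous : Continuous (Function.uncurry F)
  norm_map_le : ∀ p t, ‖F p t‖ ≤ B
  norm_map_sub_le : ∀ p q t, ‖F p t - F q t‖ ≤ L * ‖p - q‖
  integral_eq : ∀ p t, ∫ τ in t..t + T, F p τ = T • G p

namespace IsAverage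

variable {E : Type*} [NormedAddCommGroup E] [NormedSpace ℝ E] {F : E → ℝ → E} {G : E → E}
  {T B L : ℝ}

theorem bound_nonneg (h : IsAverage F G T B L) : 0 ≤ B := (norm_nonneg _).trans (h.norm_map_le 0 0)

theorem continuous_right (h : IsAverage F G T B L) (p : E) : Continuous (F p) :=
  h.continuous.comp (by fun_prop : Continuous fun t : ℝ => (p, t))

theorem average_norm_le (h : IsAverage F G T B L) (p : E) : ‖G p‖ ≤ B := by
  have h1 := intervalIntegral.norm_integral_le_of_norm_le_const (a := 0) (b := 0 + T)
    (fun t _ => h.norm_map_le p t)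
  rw [h.integral_eq, norm_smul, Real.norm_of_nonneg h.period_pos.le, zero_add, sub_zero,
    abs_of_pos h.period_pos, mul_comm] at h1
  exact le_of_mul_le_mul_right h1 h.period_pos

theorem average_norm_sub_le (h : IsAverage F G T B L) (p q : E) :
    ‖G p - G q‖ ≤ L * ‖p - q‖ := by
  have h1 := intervalIntegral.norm_integral_le_of_norm_le_const (a := 0) (b := 0 + T)
    (fun t _ => h.norm_map_sub_le p q t)
  rw [intervalIntegral.integral_sub ((h.continuous_right p).intervalIntegrable _ _)
    ((h.continuous_right q).intervalIntegrable _ _), h.integral_eq, h.integral_eq, ← smul_sub,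
    norm_smul, Real.norm_of_nonneg h.period_pos.le, zero_add, sub_zero,
    abs_of_pos h.period_pos, mul_comm] at h1
  exact le_of_mul_le_mul_right h1 h.period_pos

theorem average_continuous (h : IsAverage F G T B L) : Continuous G :=
  (LipschitzWith.of_dist_le_mul (K := L.toNNReal) fun p q => by
    rw [dist_eq_norm, dist_eq_norm, Real.coe_toNNReal _ h.lipschitz_pos.le]
    exact h.average_norm_sub_le p q).continuous

theorem exists_hasDerivAt [CompleteSpace E] (h : IsAverage F G T B L) (ε t₀ : ℝ) (x₀ : E) :
    ∃ x : ℝ → E, x t₀ = x₀ ∧ ∀ t, HasDerivAt x (ε • F (x t) t) t := by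
  refine exists_forall_hasDerivAt_of_lipschitzWith (f := fun t p => ε • F p t)
    (K := (|ε| * L).toNNReal) (B := |ε| * B) (fun t => LipschitzWith.of_dist_le_mul fun p q => ?_)
    (fun p => (h.continuous_right p).const_smul ε) (fun t p => ?_) t₀ x₀
  · rw [dist_eq_norm, dist_eq_norm, ← smul_sub, norm_smul, Real.norm_eq_abs,
      Real.coe_toNNReal _ (mul_nonneg (abs_nonneg _) h.lipschitz_pos.le), mul_assoc]
    exact mul_le_mul_of_nonneg_left (h.norm_map_sub_le p q t) (abs_nonneg _)
  · rw [norm_smul, Real.norm_eq_abs]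
    exact mul_le_mul_of_nonneg_left (h.norm_map_le p t) (abs_nonneg _)

theorem exists_hasDerivAt_average [CompleteSpace E] (h : IsAverage F G T B L) (ε t₀ : ℝ)
    (x₀ : E) : ∃ x : ℝ → E, x t₀ = x₀ ∧ ∀ t, HasDerivAt x (ε • G (x t)) t := by
  have hG : IsAverage (fun p _ => G p) G T B L :=
    { period_pos := h.period_pos
      lipschitz_pos := h.lipschitz_pos
      continuous := h.average_continuous.comp continuous_fst
      norm_map_le := fun p _ => h.average_norm_le p
      norm_map_sub_le := fun p q _ => h.average_norm_sub_le p q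
      integral_eq := fun p t => by simp }
  exact hG.exists_hasDerivAt ε t₀ x₀

theorem norm_integral_sub_average_le [CompleteSpace E] (h : IsAverage F G T B L) {x : ℝ → E}
    {v : ℝ} (hx : Continuous x) (hxv : ∀ a b, ‖x a - x b‖ ≤ v * |a - b|) {s t : ℝ} (hst : s ≤ t) :
    ‖∫ σ in s..t, (F (x σ) σ - G (x σ))‖ ≤ 2 * L * v * T * (t - s) + 2 * B * T := by
  have hT := h.period_pos
  have hL := h.lipschitz_pos
  have hcont : Continuous fun σ => F (x σ) σ - G (x σ) :=
    (h.continuous.comp (hx.prodMk continuous_id)).sub (h.average_continuous.comp hx)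
  have hint : ∀ a b, IntervalIntegrable (fun σ => F (x σ) σ - G (x σ)) MeasureTheory.volume a b :=
    fun a b => hcont.intervalIntegrable a b
  have hv : 0 ≤ v := by simpa using (norm_nonneg _).trans (hxv 1 0)
  have hstep : ∀ u ≥ s, ‖(∫ σ in s..u + T, (F (x σ) σ - G (x σ))) -
      ∫ σ in s..u, (F (x σ) σ - G (x σ))‖ ≤ 2 * L * (v * T) * T := by
    intro u _
    rw [intervalIntegral.integral_interval_sub_left (hint _ _) (hint _ _)]
    have hzero : ∫ σ in u..u + T, (F (x u) σ - G (x u)) = 0 := by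
      rw [intervalIntegral.integral_sub ((h.continuous_right _).intervalIntegrable _ _)
        (continuous_const.intervalIntegrable _ _), h.integral_eq]
      simp
    have hfreeze : ∫ σ in u..u + T, (F (x σ) σ - G (x σ)) =
        ∫ σ in u..u + T, ((F (x σ) σ - G (x σ)) - (F (x u) σ - G (x u))) := by
      rw [intervalIntegral.integral_sub (g := fun σ => F (x u) σ - G (x u)) (hint _ _)
        (((h.continuous_right _).sub continuous_const).intervalIntegrable _ _), hzero, sub_zero]
    rw [hfreeze]
    have hle := intervalIntegral.norm_integral_le_of_norm_le_const (a := u) (b := u + T)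
      (f := fun σ => (F (x σ) σ - G (x σ)) - (F (x u) σ - G (x u))) (C := 2 * L * (v * T))
      (fun σ hσ => by
        rw [uIoc_of_le (by linarith)] at hσ
        have h1 : ‖x σ - x u‖ ≤ v * T := (hxv σ u).trans (mul_le_mul_of_nonneg_left
          (by rw [abs_of_nonneg (by linarith [hσ.1])]; linarith [hσ.2]) hv)
        calc ‖(F (x σ) σ - G (x σ)) - (F (x u) σ - G (x u))‖
            = ‖(F (x σ) σ - F (x u) σ) - (G (x σ) - G (x u))‖ := by congr 1; abel
          _ ≤ L * ‖x σ - x u‖ + L * ‖x σ - x u‖ := (norm_sub_le _ _).trans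
              (add_le_add (h.norm_map_sub_le _ _ _) (h.average_norm_sub_le _ _))
          _ ≤ 2 * L * (v * T) := by nlinarith)
    simpa [abs_of_pos hT] using hle
  have hshort : ∀ u ∈ Icc s (s + T), ‖∫ σ in s..u, (F (x σ) σ - G (x σ))‖ ≤ 2 * B * T := by
    intro u hu
    have hle := intervalIntegral.norm_integral_le_of_norm_le_const (a := s) (b := u)
      (f := fun σ => F (x σ) σ - G (x σ)) (C := 2 * B) (fun σ _ =>
        (norm_sub_le _ _).trans (by linarith [h.norm_map_le (x σ) σ, h.average_norm_le (x σ)]))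
    rw [abs_of_nonneg (by linarith [hu.1])] at hle
    exact hle.trans (mul_le_mul_of_nonneg_left (by linarith [hu.2])
      (by linarith [h.bound_nonneg]))
  refine (norm_le_of_norm_add_sub_le hT hstep hshort hst).trans (le_of_eq ?_)
  field_simp

/-- First-order averaging on a time interval of length `τ / ε`. -/
theorem norm_sub_le_of_hasDerivAt [CompleteSpace E] (h : IsAverage F G T B L) {ε τ s : ℝ}
    (hε : 0 < ε) (hτ : 0 ≤ τ) {x z : ℝ → E} (hx : ∀ t ≥ s, HasDerivAt x (ε • F (x t) t) t)
    (hz : ∀ t ≥ s, HasDerivAt z (ε • G (z t)) t) {t : ℝ} (hst : s ≤ t) (ht : ε * (t - s) ≤ τ) :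
    ‖x t - z t‖ ≤ (‖x s - z s‖ + ε * (2 * L * B * T * τ + 2 * B * T)) * Real.exp (L * τ) +
      ε * (2 * L * B * T * τ + 2 * B * T) := by
  have hT := h.period_pos
  have hL := h.lipschitz_pos
  have hB := h.bound_nonneg
  set M := 2 * L * B * T * τ + 2 * B * T with hM
  have hM₀ : 0 ≤ M := by positivity
  set y : ℝ → E := fun σ => x (max σ s) with hy
  have hyx : ∀ σ ≥ s, y σ = x σ := fun σ hσ => by simp only [hy, max_eq_left hσ]
  have hxLip : ∀ a ≥ s, ∀ b ≥ s, ‖x a - x b‖ ≤ ε * B * |a - b| := by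
    intro a ha b hb
    exact (convex_Ici s).norm_image_sub_le_of_norm_hasDerivWithin_le
      (fun u hu => (hx u hu).hasDerivWithinAt) (fun u _ => by
        rw [norm_smul, Real.norm_of_nonneg hε.le]
        exact mul_le_mul_of_nonneg_left (h.norm_map_le _ _) hε.le) hb ha
  have hyLip : ∀ a b, ‖y a - y b‖ ≤ ε * B * |a - b| := fun a b =>
    (hxLip _ (le_max_right _ _) _ (le_max_right _ _)).trans
      (mul_le_mul_of_nonneg_left (abs_max_sub_max_le_abs a b s) (by positivity))
  have hyc : Continuous y := by
    refine ContinuousOn.comp_continuous (s := Ici s)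
      (fun u hu => (hx u hu).continuousAt.continuousWithinAt) (by fun_prop) fun u => le_max_right u s
  have hcont : Continuous fun σ => F (y σ) σ - G (y σ) :=
    (h.continuous.comp (hyc.prodMk continuous_id)).sub (h.average_continuous.comp hyc)
  set I : ℝ → E := fun u => ∫ σ in s..u, (F (y σ) σ - G (y σ)) with hI
  have hIderiv : ∀ u, HasDerivAt I (F (y u) u - G (y u)) u := fun u =>
    intervalIntegral.integral_hasDerivAt_right (hcont.intervalIntegrable _ _)
      hcont.stronglyMeasurable.stronglyMeasurableAtFilter hcont.continuousAt
  have hIle : ∀ u ∈ Icc s t, ‖I u‖ ≤ M := by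
    intro u hu
    refine (h.norm_integral_sub_average_le hyc hyLip hu.1).trans ?_
    have : ε * (u - s) ≤ τ := (mul_le_mul_of_nonneg_left (by linarith [hu.2]) hε.le).trans ht
    have := mul_le_mul_of_nonneg_left this (by positivity : 0 ≤ 2 * L * B * T)
    rw [hM]
    linarith
  have hd : ∀ u ≥ s, HasDerivAt (fun u => x u - z u - ε • I u)
      (ε • (G (x u) - G (z u))) u := by
    intro u hu
    refine (((hx u hu).sub (hz u hu)).sub ((hIderiv u).const_smul ε)).congr_deriv ?_
    rw [hyx u hu]
    module
  have hgron := norm_le_gronwallBound_of_norm_deriv_right_le (a := s) (b := t)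
    (f := fun u => x u - z u - ε • I u) (δ := ‖x s - z s‖) (K := ε * L) (ε := ε * L * (ε * M))
    (fun u hu => (hd u hu.1).continuousAt.continuousWithinAt)
    (fun u hu => (hd u hu.1).hasDerivWithinAt) (by simp [hI])
    (fun u hu => by
      have h1 : ‖x u - z u‖ ≤ ‖x u - z u - ε • I u‖ + ε * M := by
        have h2 := norm_le_norm_sub_add (x u - z u) (ε • I u)
        rw [norm_smul, Real.norm_of_nonneg hε.le] at h2
        have := mul_le_mul_of_nonneg_left (hIle u (Ico_subset_Icc_self hu)) hε.le
        linarith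
      rw [norm_smul, Real.norm_of_nonneg hε.le]
      calc ε * ‖G (x u) - G (z u)‖ ≤ ε * (L * ‖x u - z u‖) :=
            mul_le_mul_of_nonneg_left (h.average_norm_sub_le _ _) hε.le
        _ ≤ ε * (L * (‖x u - z u - ε • I u‖ + ε * M)) := by gcongr
        _ = _ := by ring) t ⟨hst, le_rfl⟩
  rw [gronwallBound_of_K_ne_0 (by positivity)] at hgron
  have hexp : Real.exp (ε * L * (t - s)) ≤ Real.exp (L * τ) := by
    rw [Real.exp_le_exp]
    nlinarith
  have hfrac : ε * L * (ε * M) / (ε * L) = ε * M := by field_simp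
  simp only [hfrac] at hgron
  have hIt := mul_le_mul_of_nonneg_left (hIle t ⟨hst, le_rfl⟩) hε.le
  have htri := norm_le_norm_sub_add (x t - z t) (ε • I t)
  rw [norm_smul, Real.norm_of_nonneg hε.le] at htri
  have hεM : 0 ≤ ε * M := by positivity
  have := mul_le_mul_of_nonneg_left hexp (add_nonneg (norm_nonneg (x s - z s)) hεM)
  linarith

end IsAverage

theorem hasDerivAt_comp_add_div {E : Type*} [NormedAddCommGroup E] [NormedSpace ℝ E] {G : E → E}
    {z : ℝ → E} {ε s : ℝ} (hε : 0 < ε) (hz : ∀ t ≥ s, HasDerivAt z (ε • G (z t)) t) :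
    ∀ σ ≥ 0, HasDerivAt (fun σ => z (s + σ / ε)) (G (z (s + σ / ε))) σ := by
  intro σ hσ
  have h1 : HasDerivAt (fun σ : ℝ => s + σ / ε) (1 / ε) σ :=
    ((hasDerivAt_id σ).div_const ε).const_add s
  refine ((hz (s + σ / ε) (by have := div_nonneg hσ hε.le; linarith)).scomp σ h1).congr_deriv ?_
  rw [smul_smul, one_div, inv_mul_cancel₀ hε.ne', one_smul]

/-- The flow of `G` contracts distances between orbits near an exponentially stable equilibrium,
after a suitable time. -/
theorem exists_norm_sub_le_half_of_exponentially_stable {E : Type*} [NormedAddCommGroup E]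
    [NormedSpace ℝ E] {G : E → E} {A : E →L[ℝ] E} (hA : HasStrictFDerivAt G A 0) (hG0 : G 0 = 0)
    (hex : ∀ x₀ : E, ∃ x : ℝ → E, x 0 = x₀ ∧ ∀ t, HasDerivAt x (G (x t)) t)
    {δ K lam : ℝ} (hδ : 0 < δ) (hK : 0 < K) (hlam : 0 < lam)
    (hstab : ∀ z : ℝ → E, (∀ t ≥ 0, HasDerivAt z (G (z t)) t) → ‖z 0‖ ≤ δ →
      ∀ t ≥ 0, ‖z t‖ ≤ K * Real.exp (-lam * t) * ‖z 0‖) :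
    ∃ τ > 0, ∃ r > 0, ∀ a b : ℝ → E, (∀ t ≥ 0, HasDerivAt a (G (a t)) t) →
      (∀ t ≥ 0, HasDerivAt b (G (b t)) t) → ‖a 0‖ ≤ r → ‖b 0‖ ≤ r →
      ‖a τ - b τ‖ ≤ 1 / 2 * ‖a 0 - b 0‖ := by
  obtain ⟨τ, hτ, hKτ⟩ : ∃ τ > 0, K * Real.exp (-lam * τ) ≤ 1 / 4 := by
    have h1 : Tendsto (fun τ : ℝ => K * Real.exp (-lam * τ)) atTop (𝓝 (K * 0)) :=
      (Real.tendsto_exp_atBot.comp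
        (tendsto_id.const_mul_atTop_of_neg (neg_neg_of_pos hlam))).const_mul K
    rw [mul_zero] at h1
    obtain ⟨τ, h2, h3⟩ := ((h1.eventually_le_const (by norm_num : (0 : ℝ) < 1 / 4)).and
      (eventually_gt_atTop 0)).exists
    exact ⟨τ, h3, h2⟩
  set L := ‖A‖ + 1 with hL
  have hL1 : 1 ≤ L := by simp [hL]
  set η := min 1 (1 / (8 * K * Real.exp (L * τ))) with hη
  have hη₀ : 0 < η := by positivity
  have hη1 : η ≤ 1 := min_le_left _ _
  have hη2 : 2 * η * K * Real.exp (L * τ) ≤ 1 / 4 := by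
    have h1 : η ≤ 1 / (8 * K * Real.exp (L * τ)) := min_le_right _ _
    rw [le_div_iff₀ (by positivity)] at h1
    linarith
  obtain ⟨ρ, hρ, hlin⟩ : ∃ ρ > 0, ∀ p q : E, ‖p‖ < ρ → ‖q‖ < ρ →
      ‖G p - G q - A (p - q)‖ ≤ η * ‖p - q‖ := by
    obtain ⟨ρ, hρ, h1⟩ := Metric.eventually_nhds_iff.1 (hA.isLittleO.def hη₀)
    refine ⟨ρ, hρ, fun p q hp hq => h1 (y := (p, q)) ?_⟩
    rw [Prod.dist_eq]
    simpa using ⟨hp, hq⟩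
  refine ⟨τ, hτ, min (δ / 2) (ρ / (4 * K)), by positivity, fun a b ha hb ha₀ hb₀ => ?_⟩
  have hrδ : min (δ / 2) (ρ / (4 * K)) ≤ δ / 2 := min_le_left _ _
  have hrρ : K * min (δ / 2) (ρ / (4 * K)) ≤ ρ / 4 := by
    have := mul_le_mul_of_nonneg_left (min_le_right (δ / 2) (ρ / (4 * K))) hK.le
    rwa [show K * (ρ / (4 * K)) = ρ / 4 by field_simp] at this
  set r := min (δ / 2) (ρ / (4 * K))
  obtain ⟨c, hc₀, hc⟩ := hex (a 0 - b 0)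
  have hbound : ∀ z : ℝ → E, (∀ t ≥ 0, HasDerivAt z (G (z t)) t) → ‖z 0‖ ≤ δ →
      ∀ t ≥ 0, ‖z t‖ ≤ K * ‖z 0‖ := by
    intro z hz hz₀ t ht
    refine (hstab z hz hz₀ t ht).trans ?_
    have : Real.exp (-lam * t) ≤ 1 := Real.exp_le_one_iff.2 (by nlinarith)
    have := mul_le_mul_of_nonneg_left this (by positivity : 0 ≤ K * ‖z 0‖)
    linarith
  have hc₀le : ‖c 0‖ ≤ 2 * r := by
    rw [hc₀]
    exact (norm_sub_le _ _).trans (by linarith)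
  have hKr : ∀ y : ℝ, y ≤ 2 * r → K * y < ρ := fun y hy => by
    have := mul_le_mul_of_nonneg_left hy hK.le
    linarith
  have hat : ∀ t ≥ 0, ‖a t‖ < ρ := fun t ht =>
    (hbound a ha (by linarith) t ht).trans_lt (hKr _ (by linarith [norm_nonneg (a 0)]))
  have hbt : ∀ t ≥ 0, ‖b t‖ < ρ := fun t ht =>
    (hbound b hb (by linarith) t ht).trans_lt (hKr _ (by linarith [norm_nonneg (b 0)]))
  have hctle : ∀ t ≥ 0, ‖c t‖ ≤ K * ‖c 0‖ :=
    hbound c (fun t _ => hc t) (by linarith)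
  have hct : ∀ t ≥ 0, ‖c t‖ < ρ := fun t ht => (hctle t ht).trans_lt (hKr _ hc₀le)
  have hd : ∀ t ≥ 0, HasDerivAt (fun t => a t - b t - c t) (G (a t) - G (b t) - G (c t)) t :=
    fun t ht => ((ha t ht).sub (hb t ht)).sub (hc t)
  have hgron := norm_le_gronwallBound_of_norm_deriv_right_le (a := 0) (b := τ)
    (f := fun t => a t - b t - c t) (δ := 0) (K := L) (ε := 2 * η * K * ‖c 0‖)
    (fun u hu => (hd u hu.1).continuousAt.continuousWithinAt)
    (fun u hu => (hd u hu.1).hasDerivWithinAt) (by simp [hc₀])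
    (fun t ht => by
      have h1 := hlin (a t) (b t) (hat t ht.1) (hbt t ht.1)
      have h2 := hlin (c t) 0 (hct t ht.1) (by simpa using hρ)
      rw [hG0, sub_zero, sub_zero] at h2
      have h3 := norm_le_norm_sub_add (a t - b t) (c t)
      have h4 := A.le_opNorm (a t - b t - c t)
      have h5 := mul_le_mul_of_nonneg_left (hctle t ht.1) hη₀.le
      have h6 := mul_le_mul_of_nonneg_left h3 hη₀.le
      have h7 := mul_le_mul_of_nonneg_right hη1 (norm_nonneg (a t - b t - c t))
      calc ‖G (a t) - G (b t) - G (c t)‖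
          = ‖A (a t - b t - c t) + (G (a t) - G (b t) - A (a t - b t)) -
              (G (c t) - A (c t))‖ := by
            rw [map_sub A (a t - b t)]
            congr 1
            abel
        _ ≤ ‖A (a t - b t - c t)‖ + ‖G (a t) - G (b t) - A (a t - b t)‖ +
              ‖G (c t) - A (c t)‖ :=
            (norm_sub_le _ _).trans (add_le_add_left (norm_add_le _ _) _)
        _ ≤ L * ‖a t - b t - c t‖ + 2 * η * K * ‖c 0‖ := by
            rw [hL]
            linarith) τ ⟨hτ.le, le_rfl⟩
  rw [gronwallBound_of_K_ne_0 (by positivity)] at hgron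
  simp only [sub_zero, zero_mul, zero_add] at hgron
  have hh : ‖a τ - b τ - c τ‖ ≤ 1 / 4 * ‖c 0‖ := by
    refine hgron.trans ?_
    have h1 : 2 * η * K * ‖c 0‖ / L ≤ 2 * η * K * ‖c 0‖ := div_le_self (by positivity) hL1
    have h2 : Real.exp (L * τ) - 1 ≤ Real.exp (L * τ) := by linarith
    calc 2 * η * K * ‖c 0‖ / L * (Real.exp (L * τ) - 1)
        ≤ 2 * η * K * ‖c 0‖ * Real.exp (L * τ) := by
          refine mul_le_mul h1 h2 ?_ (by positivity)
          linarith [Real.one_le_exp (by positivity : 0 ≤ L * τ)]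
      _ = 2 * η * K * Real.exp (L * τ) * ‖c 0‖ := by ring
      _ ≤ 1 / 4 * ‖c 0‖ := mul_le_mul_of_nonneg_right hη2 (norm_nonneg _)
  have hcτ : ‖c τ‖ ≤ 1 / 4 * ‖c 0‖ :=
    (hstab c (fun t _ => hc t) (by linarith) τ hτ.le).trans
      (mul_le_mul_of_nonneg_right hKτ (norm_nonneg _))
  have := norm_le_norm_sub_add (a τ - b τ) (c τ)
  rw [← hc₀]
  linarith

namespace IsAverage

variable {E : Type*} [NormedAddCommGroup E] [NormedSpace ℝ E] {F : E → ℝ → E} {G : E → E}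
  {T B L : ℝ}

theorem exists_hasStrictFDerivAt_average (h : IsAverage F G T B L)
    (hF : ContDiff ℝ 2 (Function.uncurry F)) {B₂ : ℝ}
    (hB₂ : ∀ p, ‖iteratedFDeriv ℝ 2 (Function.uncurry F) p‖ ≤ B₂) (x : E) :
    ∃ A : E →L[ℝ] E, HasStrictFDerivAt G A x := by
  have hT := h.period_pos
  set D : E → ℝ → E →L[ℝ] E := fun p t =>
    (fderiv ℝ (Function.uncurry F) (p, t)).comp (ContinuousLinearMap.inl ℝ E ℝ) with hD
  have hderiv : ∀ p t, HasFDerivAt (fun p => F p t) (D p t) p := fun p t =>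
    HasFDerivAt.comp (g := Function.uncurry F) (f := fun e => (e, t)) p
      (hF.differentiable (by norm_num)).differentiableAt.hasFDerivAt (hasFDerivAt_prodMk_left p t)
  have hf' : ContDiff ℝ 1 (fderiv ℝ (Function.uncurry F)) := hF.fderiv_right (by norm_num)
  have hDlip : ∀ p q t, ‖D p t - D q t‖ ≤ B₂ * ‖p - q‖ := by
    intro p q t
    have h1 : ‖fderiv ℝ (Function.uncurry F) (p, t) - fderiv ℝ (Function.uncurry F) (q, t)‖ ≤
        B₂ * ‖(p, t) - (q, t)‖ :=
      convex_univ.norm_image_sub_le_of_norm_fderiv_le (𝕜 := ℝ)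
        (fun y _ => (hf'.differentiable (by norm_num)).differentiableAt)
        (fun y _ => by
          rw [← norm_iteratedFDeriv_one, norm_iteratedFDeriv_fderiv]
          exact hB₂ y) (mem_univ _) (mem_univ _)
    rw [Prod.mk_sub_mk, sub_self, Prod.norm_mk, norm_zero, max_eq_left (norm_nonneg _)] at h1
    rw [hD, ← ContinuousLinearMap.sub_comp]
    refine (ContinuousLinearMap.opNorm_comp_le _ _).trans ?_
    refine (mul_le_of_le_one_right (norm_nonneg _) ?_).trans h1
    exact ContinuousLinearMap.norm_inl_le_one ℝ E ℝ
  have hDcont : Continuous (D x) := by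
    have h1 : Continuous fun t : ℝ => fderiv ℝ (Function.uncurry F) (x, t) :=
      hf'.continuous.comp (by fun_prop)
    exact h1.clm_comp continuous_const
  refine ⟨(1 / T) • ∫ t in (0 : ℝ)..0 + T, D x t, .of_isLittleO ?_⟩
  rw [Asymptotics.isLittleO_iff]
  intro c hc
  have hB₂₀ : 0 ≤ B₂ := (norm_nonneg _).trans (hB₂ 0)
  have hr : 0 < c / (B₂ + 1) := by positivity
  have hball : ∀ p ∈ ball x (c / (B₂ + 1)), ∀ t, ‖D p t - D x t‖ ≤ c := by
    intro p hp t
    refine (hDlip p x t).trans ?_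
    rw [mem_ball_iff_norm, lt_div_iff₀ (by positivity)] at hp
    nlinarith [norm_nonneg (p - x)]
  filter_upwards [prod_mem_nhds (ball_mem_nhds x hr) (ball_mem_nhds x hr)] with pq hpq
  obtain ⟨p, q⟩ := pq
  have hint : ∀ t, ‖F p t - F q t - D x t (p - q)‖ ≤ c * ‖p - q‖ := fun t =>
    (convex_ball x _).norm_image_sub_le_of_norm_hasFDerivWithin_le'
      (fun y _ => (hderiv y t).hasFDerivWithinAt) (fun y hy => hball y hy t) hpq.2 hpq.1
  have hle := intervalIntegral.norm_integral_le_of_norm_le_const (a := 0) (b := 0 + T)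
    (fun t _ => hint t)
  have hFi : ∀ y, IntervalIntegrable (F y) MeasureTheory.volume 0 (0 + T) := fun y =>
    (h.continuous_right y).intervalIntegrable _ _
  have hDi : IntervalIntegrable (D x) MeasureTheory.volume 0 (0 + T) :=
    hDcont.intervalIntegrable _ _
  have hDpi : IntervalIntegrable (fun t => D x t (p - q)) MeasureTheory.volume 0 (0 + T) :=
    (hDcont.clm_apply continuous_const).intervalIntegrable _ _
  rw [intervalIntegral.integral_sub ((hFi p).sub (hFi q)) hDpi,
    intervalIntegral.integral_sub (hFi p) (hFi q), h.integral_eq, h.integral_eq,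
    ← ContinuousLinearMap.intervalIntegral_apply hDi, zero_add, sub_zero, abs_of_pos hT] at hle
  have hscale : G p - G q - ((1 / T) • ∫ t in (0 : ℝ)..0 + T, D x t) (p - q) =
      (1 / T) • (T • G p - T • G q - (∫ t in (0 : ℝ)..T, D x t) (p - q)) := by
    rw [zero_add, smul_sub, smul_sub, smul_smul, smul_smul, one_div, inv_mul_cancel₀ hT.ne',
      one_smul, one_smul, smul_apply]
  rw [hscale, norm_smul, Real.norm_of_nonneg (by positivity), one_div, inv_mul_le_iff₀ hT]
  linarith

/-- First-order averaging on an infinite time interval, near an exponentially stable equilibrium of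
the averaged field. -/
theorem exists_norm_sub_lt [CompleteSpace E] (h : IsAverage F G T B L) {A : E →L[ℝ] E}
    (hA : HasStrictFDerivAt G A 0) (hG0 : G 0 = 0) {δ K lam : ℝ} (hδ : 0 < δ) (hK : 0 < K)
    (hlam : 0 < lam)
    (hstab : ∀ z : ℝ → E, (∀ t ≥ 0, HasDerivAt z (G (z t)) t) → ‖z 0‖ ≤ δ →
      ∀ t ≥ 0, ‖z t‖ ≤ K * Real.exp (-lam * t) * ‖z 0‖) :
    ∃ ρ > 0, ∃ ε₀ > 0, ∃ C > 0, ∀ ε > 0, ε < ε₀ → ∀ (t₀ : ℝ) (z x : ℝ → E),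
      ‖z t₀‖ ≤ ρ → x t₀ = z t₀ → (∀ t ≥ t₀, HasDerivAt z (ε • G (z t)) t) →
      (∀ t ≥ t₀, HasDerivAt x (ε • F (x t) t) t) → ∀ t ≥ t₀, ‖x t - z t‖ < C * ε := by
  have hT := h.period_pos
  have hL := h.lipschitz_pos
  have hB := h.bound_nonneg
  obtain ⟨τ, hτ, r, hr, hcontr⟩ := exists_norm_sub_le_half_of_exponentially_stable hA hG0
    (fun x₀ => by simpa using h.exists_hasDerivAt_average 1 0 x₀) hδ hK hlam hstab
  set M := 2 * L * B * T * τ + 2 * B * T with hM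
  have hM₀ : 0 ≤ M := by positivity
  set C₁ := M * Real.exp (L * τ) + M + 1 with hC₁
  have hC₁₀ : 0 < C₁ := by positivity
  refine ⟨min δ (r / (2 * K)), by positivity, r / (4 * C₁), by positivity,
    2 * C₁ * Real.exp (L * τ) + C₁, by positivity, ?_⟩
  intro ε hε hεε₀ t₀ z x hz₀ hxz hz hx
  have hz₀δ : ‖z t₀‖ ≤ δ := hz₀.trans (min_le_left _ _)
  have hz₀r : K * ‖z t₀‖ ≤ r / 2 := by
    have := mul_le_mul_of_nonneg_left (hz₀.trans (min_le_right _ _)) hK.le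
    rwa [show K * (r / (2 * K)) = r / 2 by field_simp] at this
  have hzr : ∀ t ≥ t₀, ‖z t‖ ≤ r / 2 := by
    intro t ht
    have h1 := hstab _ (hasDerivAt_comp_add_div hε hz) (by simpa using hz₀δ) (ε * (t - t₀))
      (mul_nonneg hε.le (by linarith))
    have h2 : t₀ + ε * (t - t₀) / ε = t := by field_simp; ring
    simp only [h2, zero_div, add_zero] at h1
    have h3 : Real.exp (-lam * (ε * (t - t₀))) ≤ 1 := by
      rw [Real.exp_le_one_iff, neg_mul]
      have : 0 ≤ t - t₀ := by linarith
      simpa using (by positivity : 0 ≤ lam * (ε * (t - t₀)))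
    have := mul_le_mul_of_nonneg_left h3 (by positivity : 0 ≤ K * ‖z t₀‖)
    linarith
  have hτε : 0 < τ / ε := by positivity
  have hsmall : 2 * C₁ * ε ≤ r / 2 := by
    rw [lt_div_iff₀ (by positivity)] at hεε₀
    linarith
  have hgrid : ∀ k : ℕ, ‖x (t₀ + k * (τ / ε)) - z (t₀ + k * (τ / ε))‖ ≤ 2 * C₁ * ε := by
    intro k
    induction k with
    | zero => simpa [hxz] using (by positivity : 0 ≤ 2 * C₁ * ε)
    | succ k ih =>
      have hs : t₀ ≤ t₀ + k * (τ / ε) := by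
        have : 0 ≤ k * (τ / ε) := by positivity
        linarith
      rw [show t₀ + ((k + 1 : ℕ) : ℝ) * (τ / ε) = t₀ + k * (τ / ε) + τ / ε by push_cast; ring]
      set s := t₀ + k * (τ / ε)
      obtain ⟨y, hy₀, hy⟩ := h.exists_hasDerivAt_average ε s (x s)
      have hxy := h.norm_sub_le_of_hasDerivAt hε hτ.le (fun t ht => hx t (hs.trans ht))
        (fun t _ => hy t) (by linarith : s ≤ s + τ / ε) (le_of_eq (by field_simp; ring))
      rw [hy₀, sub_self, norm_zero, zero_add, ← hM] at hxy
      have hyr : ‖y s‖ ≤ r := by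
        rw [hy₀]
        have := norm_le_norm_sub_add (x s) (z s)
        linarith [hzr s hs]
      have hyz := hcontr _ _ (hasDerivAt_comp_add_div hε fun t (_ : t ≥ s) => hy t)
        (hasDerivAt_comp_add_div hε fun t ht => hz t (hs.trans ht)) (by simpa using hyr)
        (by simpa using (hzr s hs).trans (by linarith))
      simp only [zero_div, add_zero, hy₀] at hyz
      have := norm_sub_le_norm_sub_add_norm_sub (x (s + τ / ε)) (y (s + τ / ε)) (z (s + τ / ε))
      rw [hC₁] at ih ⊢
      linarith
  intro t ht
  have hq : 0 ≤ (t - t₀) / (τ / ε) := div_nonneg (by linarith) hτε.le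
  have h1 := Nat.floor_le hq
  have h2 := Nat.lt_floor_add_one ((t - t₀) / (τ / ε))
  rw [le_div_iff₀ hτε] at h1
  rw [div_lt_iff₀ hτε] at h2
  have hk := hgrid ⌊(t - t₀) / (τ / ε)⌋₊
  have hs : t₀ ≤ t₀ + ⌊(t - t₀) / (τ / ε)⌋₊ * (τ / ε) := by
    have : 0 ≤ ⌊(t - t₀) / (τ / ε)⌋₊ * (τ / ε) := by positivity
    linarith
  set s := t₀ + ⌊(t - t₀) / (τ / ε)⌋₊ * (τ / ε) with hsdef
  have hεt : ε * (t - s) ≤ τ := by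
    have h3 : t - s ≤ τ / ε := by linarith
    rwa [le_div_iff₀ hε, mul_comm] at h3
  have hxz' := h.norm_sub_le_of_hasDerivAt hε hτ.le (fun u hu => hx u (hs.trans hu))
    (fun u hu => hz u (hs.trans hu)) (by linarith : s ≤ t) hεt
  rw [← hM] at hxz'
  have h4 := mul_le_mul_of_nonneg_right hk (Real.exp_pos (L * τ)).le
  have h5 : ε * M * Real.exp (L * τ) + ε * M < C₁ * ε := by
    rw [hC₁]
    linarith
  linarith

end IsAverage

/-- First-order averaging on an infinite time interval. If the origin is
an exponentially stable equilibrium of the averaged system `ż = G₁(z)`, then there are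
a compact neighborhood `V` of the origin, `ε₀ > 0` and `C > 0` such that for every
`z₀ ∈ V` and `ε ∈ (0, ε₀)`, the solutions of `ẋ = ε F₁(x,t)` and `ż = ε G₁(z)`
starting from `z₀` at `t₀` exist on `[t₀, ∞)` and satisfy `‖x(t) − z(t)‖ < C ε`
for all `t ≥ t₀`. -/
theorem first_order_averaging_infinite_time
    (n : ℕ) (T : ℝ) (hT : 0 < T)
    (F₁ : EuclideanSpace ℝ (Fin n) → ℝ → EuclideanSpace ℝ (Fin n))
    (G₁ : EuclideanSpace ℝ (Fin n) → EuclideanSpace ℝ (Fin n))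
    (hF₁_per : ∀ z, Function.Periodic (F₁ z) T)
    (hF₁_smooth : ContDiff ℝ 2 (Function.uncurry F₁))
    (hF₁_bdd : ∃ B : ℝ, ∀ i : ℕ, i ≤ 2 →
      ∀ p : EuclideanSpace ℝ (Fin n) × ℝ,
        ‖iteratedFDeriv ℝ i (Function.uncurry F₁) p‖ ≤ B)
    (hG₁ : ∀ z, G₁ z = (1 / T) • ∫ τ in (0:ℝ)..T, F₁ z τ)
    -- the origin is an exponentially stable equilibrium of ż = G₁(z)
    (hG₁0 : G₁ 0 = 0)
    (hstab : ∃ δ K lam : ℝ, 0 < δ ∧ 0 < K ∧ 0 < lam ∧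
      ∀ (t₀ : ℝ) (z : ℝ → EuclideanSpace ℝ (Fin n)),
        (∀ t ≥ t₀, HasDerivAt z (G₁ (z t)) t) → ‖z t₀‖ ≤ δ →
        ∀ t ≥ t₀, ‖z t‖ ≤ K * Real.exp (-lam * (t - t₀)) * ‖z t₀‖) :
    ∃ V : Set (EuclideanSpace ℝ (Fin n)), IsCompact V ∧ V ∈ nhds (0 : EuclideanSpace ℝ (Fin n)) ∧
      ∃ ε₀ C : ℝ, 0 < ε₀ ∧ 0 < C ∧
        ∀ z₀ ∈ V, ∀ ε : ℝ, 0 < ε → ε < ε₀ → ∀ t₀ : ℝ,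
          -- existence of the solutions on [t₀, ∞)
          (∃ z : ℝ → EuclideanSpace ℝ (Fin n), z t₀ = z₀ ∧
            ∀ t ≥ t₀, HasDerivAt z (ε • G₁ (z t)) t) ∧
          (∃ x : ℝ → EuclideanSpace ℝ (Fin n), x t₀ = z₀ ∧
            ∀ t ≥ t₀, HasDerivAt x (ε • F₁ (x t) t) t) ∧
          -- the closeness estimate on the infinite time interval
          (∀ z x : ℝ → EuclideanSpace ℝ (Fin n),
            z t₀ = z₀ → (∀ t ≥ t₀, HasDerivAt z (ε • G₁ (z t)) t) →
            x t₀ = z₀ → (∀ t ≥ t₀, HasDerivAt x (ε • F₁ (x t) t) t) →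
            ∀ t ≥ t₀, ‖x t - z t‖ < C * ε) := by
  obtain ⟨B, hB⟩ := hF₁_bdd
  obtain ⟨δ, K, lam, hδ, hK, hlam, hstab⟩ := hstab
  have hB₀ : 0 ≤ B := (norm_nonneg _).trans (hB 0 (by norm_num) 0)
  have hint : ∀ p t, ∫ τ in t..t + T, F₁ p τ = T • G₁ p := fun p t => by
    rw [hG₁, smul_smul, mul_one_div_cancel hT.ne', one_smul,
      (hF₁_per p).intervalIntegral_add_eq t 0, zero_add]
  have havg : IsAverage F₁ G₁ T B (B + 1) :=
    { period_pos := hT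
      lipschitz_pos := by positivity
      continuous := hF₁_smooth.continuous
      norm_map_le := fun p t => by
        simpa [norm_iteratedFDeriv_zero] using hB 0 (by norm_num) (p, t)
      norm_map_sub_le := fun p q t => by
        have h1 := convex_univ.norm_image_sub_le_of_norm_fderiv_le (𝕜 := ℝ)
          (f := Function.uncurry F₁) (C := B)
          (fun y _ => (hF₁_smooth.differentiable (by norm_num)).differentiableAt)
          (fun y _ => by
            rw [← norm_iteratedFDeriv_one]
            exact hB 1 (by norm_num) y) (mem_univ (q, t)) (mem_univ (p, t))
        rw [Prod.mk_sub_mk, sub_self, Prod.norm_mk, norm_zero, max_eq_left (norm_nonneg _)] at h1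
        exact h1.trans (mul_le_mul_of_nonneg_right (by linarith) (norm_nonneg _))
      integral_eq := hint }
  obtain ⟨A, hA⟩ := havg.exists_hasStrictFDerivAt_average hF₁_smooth (hB 2 le_rfl) 0
  obtain ⟨ρ, hρ, ε₀, hε₀, C, hC, hclose⟩ := havg.exists_norm_sub_lt hA hG₁0 hδ hK hlam
    (fun z hz hz₀ t ht => by simpa using hstab 0 z hz hz₀ t ht)
  refine ⟨closedBall 0 ρ, isCompact_closedBall 0 ρ, closedBall_mem_nhds 0 hρ, ε₀, C, hε₀, hC, ?_⟩
  intro z₀ hz₀ ε hε hεε₀ t₀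
  obtain ⟨z, hz, hz'⟩ := havg.exists_hasDerivAt_average ε t₀ z₀
  obtain ⟨x, hx, hx'⟩ := havg.exists_hasDerivAt ε t₀ z₀
  refine ⟨⟨z, hz, fun t _ => hz' t⟩, ⟨x, hx, fun t _ => hx' t⟩, ?_⟩
  intro z x hz hz' hx hx'
  exact hclose ε hε hεε₀ t₀ z x (by rw [hz]; exact mem_closedBall_zero_iff.1 hz₀)
    (hx.trans hz.symm) hz' hx'
end

section
/- (Second-order averaging on an infinite time interval.) Consider ẋ = ε F₁(x, t) + ε² F₂(x, t), where F₁, F₂ : ℝⁿ × ℝ → ℝⁿ are C² (F₁ being C³), bounded with bounded derivatives, and T-periodic in t. Define G₁(z) := (1/T)∫₀ᵀ F₁(z, τ) dτ; w(z, t) := ∫₀ᵗ (F₁(z, τ) − G₁(z)) dτ; ψ₁(z, t) := w(z, t) − (1/T)∫₀ᵀ w(z, τ) dτ; K₂(z, t) := F₂(z, t) + D_z F₁(z, t)·ψ₁(z, t) − D_z ψ₁(z, t)·G₁(z); and G₂(z) := (1/T)∫₀ᵀ K₂(z, τ) dτ; and consider the truncated averaged system ż = ε G₁(z) + ε² G₂(z).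 Suppose the origin is an exponentially stable equilibrium of ż = G₁(z). Then there exist a compact neighborhood V of the origin, ε₀ > 0, and C > 0 such that for every ε ∈ (0, ε₀) and every z₀ ∈ V: the solution z(t) of the truncated averaged system with z(t₀) = z₀ and the solution x(t) of the original system with x(t₀) = z₀ + ε ψ₁(z₀, t₀) both exist on [t₀, +∞), and sup_{t ∈ [t₀, +∞)} ‖x(t) − z(t) − ε ψ₁(z(t), t)‖ < C ε². -/
section SecondOrderAveraging

open MeasureTheory Set Filter Topology
open scoped NNReal

section Averaging

variable {X F G : Type*} [NormedAddCommGroup F]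

/-- The mean of `f x` over one period. -/
noncomputable def periodAvg [NormedSpace ℝ F] (T : ℝ) (f : X → ℝ → F) (x : X) : F :=
  (1 / T) • ∫ τ in (0:ℝ)..T, f x τ

/-- The primitive vanishing at time `0` of the oscillating part of `f`. -/
noncomputable def oscPrimitive [NormedSpace ℝ F] (T : ℝ) (f : X → ℝ → F) (x : X) (t : ℝ) :
    F :=
  ∫ τ in (0:ℝ)..t, (f x τ - periodAvg T f x)

lemma norm_periodAvg_le [NormedSpace ℝ F] {T : ℝ} {f : X → ℝ → F} (hT : 0 < T) {B : ℝ}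
    (hB : ∀ x t, ‖f x t‖ ≤ B) (x : X) : ‖periodAvg T f x‖ ≤ B := by
  have h := intervalIntegral.norm_integral_le_of_norm_le_const (a := 0) (b := T)
    (f := f x) (C := B) (fun t _ => hB x t)
  rw [periodAvg, norm_smul, Real.norm_of_nonneg (by positivity)]
  rw [sub_zero, abs_of_pos hT] at h
  calc 1 / T * ‖∫ τ in (0:ℝ)..T, f x τ‖ ≤ 1 / T * (B * T) := by gcongr
    _ = B := by field_simp

variable [NormedAddCommGroup X]

/-- A jointly continuous, bounded, time-periodic function. -/
structure IsPeriodicBdd (T : ℝ) (f : X → ℝ → F) : Prop where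
  cont : Continuous (Function.uncurry f)
  per : ∀ x t, f x (t + T) = f x t
  bdd : ∃ B, ∀ x t, ‖f x t‖ ≤ B

/-- A function and its spatial derivative, both jointly continuous, bounded and time-periodic. -/
structure IsPeriodicC1 [NormedSpace ℝ X] [NormedSpace ℝ F] (T : ℝ) (f : X → ℝ → F)
    (f' : X → ℝ → X →L[ℝ] F) : Prop where
  left : IsPeriodicBdd T f
  right : IsPeriodicBdd T f'
  hasFDerivAt : ∀ x t, HasFDerivAt (fun y => f y t) (f' x t) x

namespace IsPeriodicBdd

variable {T : ℝ} {f g : X → ℝ → F}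

lemma continuous_right (hf : IsPeriodicBdd T f) (x : X) : Continuous (f x) :=
  hf.cont.comp (by fun_prop : Continuous fun t : ℝ => (x, t))

lemma intervalIntegrable (hf : IsPeriodicBdd T f) (x : X) (a b : ℝ) :
    IntervalIntegrable (f x) volume a b :=
  (hf.continuous_right x).intervalIntegrable a b

lemma add (hf : IsPeriodicBdd T f) (hg : IsPeriodicBdd T g) :
    IsPeriodicBdd T (fun x t => f x t + g x t) where
  cont := hf.cont.add hg.cont
  per x t := by rw [hf.per, hg.per]
  bdd := by
    obtain ⟨B, hB⟩ := hf.bdd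
    obtain ⟨C, hC⟩ := hg.bdd
    exact ⟨B + C, fun x t => (norm_add_le _ _).trans (add_le_add (hB x t) (hC x t))⟩

lemma sub (hf : IsPeriodicBdd T f) (hg : IsPeriodicBdd T g) :
    IsPeriodicBdd T (fun x t => f x t - g x t) where
  cont := hf.cont.sub hg.cont
  per x t := by rw [hf.per, hg.per]
  bdd := by
    obtain ⟨B, hB⟩ := hf.bdd
    obtain ⟨C, hC⟩ := hg.bdd
    exact ⟨B + C, fun x t => (norm_sub_le _ _).trans (add_le_add (hB x t) (hC x t))⟩

variable [NormedSpace ℝ F] [NormedAddCommGroup G] [NormedSpace ℝ G]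

lemma bilin {H : Type*} [NormedAddCommGroup H] [NormedSpace ℝ H] (b : F →L[ℝ] G →L[ℝ] H)
    {g : X → ℝ → G} (hf : IsPeriodicBdd T f) (hg : IsPeriodicBdd T g) :
    IsPeriodicBdd T (fun x t => b (f x t) (g x t)) where
  cont := (b.continuous.comp hf.cont).clm_apply hg.cont
  per x t := by rw [hf.per, hg.per]
  bdd := by
    obtain ⟨B, hB⟩ := hf.bdd
    obtain ⟨C, hC⟩ := hg.bdd
    refine ⟨‖b‖ * B * C, fun x t => (b.le_opNorm₂ _ _).trans ?_⟩
    have := (norm_nonneg _).trans (hB x t)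
    gcongr
    exacts [hB x t, hC x t]

lemma periodAvg_continuous (hf : IsPeriodicBdd T f) : Continuous (periodAvg T f) := by
  unfold periodAvg
  exact (intervalIntegral.continuous_parametric_intervalIntegral_of_continuous'
    hf.cont 0 T).const_smul _

lemma periodAvg (hT : 0 < T) (hf : IsPeriodicBdd T f) :
    IsPeriodicBdd T (fun x _ => periodAvg T f x) where
  cont := hf.periodAvg_continuous.comp continuous_fst
  per _ _ := rfl
  bdd := hf.bdd.imp fun _ hB x _ => norm_periodAvg_le hT hB x

lemma oscPrimitive_add_period [CompleteSpace F] (hT : 0 < T) (hf : IsPeriodicBdd T f) (x : X)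
    (t : ℝ) : oscPrimitive T f x (t + T) = oscPrimitive T f x t := by
  have hc : Continuous fun τ => f x τ - _root_.periodAvg T f x :=
    (hf.continuous_right x).sub continuous_const
  have hper : Function.Periodic (fun τ => f x τ - _root_.periodAvg T f x) T := fun τ => by
    simp only [hf.per]
  have h0 : ∫ τ in t..(t + T), (f x τ - _root_.periodAvg T f x) = 0 := by
    rw [hper.intervalIntegral_add_eq t 0, zero_add,
      intervalIntegral.integral_sub (hf.intervalIntegrable x 0 T) (by simp),
      intervalIntegral.integral_const, _root_.periodAvg, smul_smul]
    simp [hT.ne']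
  have := intervalIntegral.integral_add_adjacent_intervals (a := 0) (b := t) (c := t + T)
    (hc.intervalIntegrable _ _) (hc.intervalIntegrable _ _) (μ := volume)
  rw [h0, add_zero] at this
  exact this.symm

lemma oscPrimitive [CompleteSpace F] (hT : 0 < T) (hf : IsPeriodicBdd T f) :
    IsPeriodicBdd T (oscPrimitive T f) where
  cont := by
    have h := (hf.sub (hf.periodAvg hT)).cont
    exact intervalIntegral.continuous_parametric_primitive_of_continuous
      (f := fun x t => f x t - _root_.periodAvg T f x) h
  per := hf.oscPrimitive_add_period hT
  bdd := by
    obtain ⟨B, hB⟩ := hf.bdd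
    refine ⟨(B + B) * T, fun x t => ?_⟩
    have hp : Function.Periodic (_root_.oscPrimitive T f x) T := hf.oscPrimitive_add_period hT x
    obtain ⟨s, hs, hst⟩ := hp.exists_mem_Ico₀ hT t
    rw [hst]
    have h := intervalIntegral.norm_integral_le_of_norm_le_const (a := 0) (b := s)
      (f := fun τ => f x τ - _root_.periodAvg T f x) (C := B + B)
      (fun t _ => (norm_sub_le _ _).trans (add_le_add (hB x t) (norm_periodAvg_le hT hB x)))
    refine h.trans ?_
    have hB0 := (norm_nonneg _).trans (hB x 0)
    rw [sub_zero, abs_of_nonneg hs.1]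
    have := hs.2.le
    gcongr

lemma hasDerivAt_oscPrimitive [CompleteSpace F] (hf : IsPeriodicBdd T f) (x : X) (t : ℝ) :
    HasDerivAt (_root_.oscPrimitive T f x) (f x t - _root_.periodAvg T f x) t := by
  have hc : Continuous fun τ => f x τ - _root_.periodAvg T f x :=
    (hf.continuous_right x).sub continuous_const
  exact hc.integral_hasStrictDerivAt 0 t |>.hasDerivAt

end IsPeriodicBdd

variable [NormedSpace ℝ X] [NormedSpace ℝ F] [NormedAddCommGroup G] [NormedSpace ℝ G]

lemma hasFDerivAt_intervalIntegral_of_bounded [CompleteSpace F] {f : X → ℝ → F}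
    {f' : X → ℝ → X →L[ℝ] F} (hf : Continuous (Function.uncurry f))
    (hf' : Continuous (Function.uncurry f')) (hb : ∃ B, ∀ x t, ‖f' x t‖ ≤ B)
    (hd : ∀ x t, HasFDerivAt (fun y => f y t) (f' x t) x) (x : X) (a b : ℝ) :
    HasFDerivAt (fun y => ∫ τ in a..b, f y τ) (∫ τ in a..b, f' x τ) x := by
  obtain ⟨B, hB⟩ := hb
  have hc (y : X) : Continuous (f y) := hf.comp (by fun_prop : Continuous fun t : ℝ => (y, t))
  have hc' (y : X) : Continuous (f' y) := hf'.comp (by fun_prop : Continuous fun t : ℝ => (y, t))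
  refine intervalIntegral.hasFDerivAt_integral_of_dominated_of_fderiv_le (s := univ)
    (bound := fun _ => B) univ_mem (Eventually.of_forall fun y => ?_)
    ((hc x).intervalIntegrable _ _) ?_ (ae_of_all _ fun t _ y _ => hB y t) (by simp)
    (ae_of_all _ fun t _ y _ => hd y t)
  · exact (hc y).aestronglyMeasurable
  · exact (hc' x).aestronglyMeasurable

namespace IsPeriodicC1

variable {T : ℝ} {f g : X → ℝ → F} {f' g' : X → ℝ → X →L[ℝ] F}

lemma add (hf : IsPeriodicC1 T f f') (hg : IsPeriodicC1 T g g') :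
    IsPeriodicC1 T (fun x t => f x t + g x t) (fun x t => f' x t + g' x t) where
  left := hf.left.add hg.left
  right := hf.right.add hg.right
  hasFDerivAt x t := (hf.hasFDerivAt x t).add (hg.hasFDerivAt x t)

lemma sub (hf : IsPeriodicC1 T f f') (hg : IsPeriodicC1 T g g') :
    IsPeriodicC1 T (fun x t => f x t - g x t) (fun x t => f' x t - g' x t) where
  left := hf.left.sub hg.left
  right := hf.right.sub hg.right
  hasFDerivAt x t := (hf.hasFDerivAt x t).sub (hg.hasFDerivAt x t)

lemma clm_apply {L : X → ℝ → F →L[ℝ] G} {L' : X → ℝ → X →L[ℝ] F →L[ℝ] G}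
    (hL : IsPeriodicC1 T L L') (hf : IsPeriodicC1 T f f') :
    IsPeriodicC1 T (fun x t => L x t (f x t))
      (fun x t => (L x t).comp (f' x t) + (L' x t).flip (f x t)) where
  left := hL.left.bilin (.id ℝ _) hf.left
  right := (hL.left.bilin (ContinuousLinearMap.compL ℝ X F G) hf.right).add
    (hL.right.bilin
      (ContinuousLinearMap.flipₗᵢ ℝ X F G).toContinuousLinearEquiv.toContinuousLinearMap hf.left)
  hasFDerivAt x t := (hL.hasFDerivAt x t).clm_apply (hf.hasFDerivAt x t)

lemma periodAvg_hasFDerivAt [CompleteSpace F] (hf : IsPeriodicC1 T f f') (x : X) :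
    HasFDerivAt (periodAvg T f) (periodAvg T f' x) x :=
  (hasFDerivAt_intervalIntegral_of_bounded hf.left.cont hf.right.cont hf.right.bdd
    hf.hasFDerivAt x 0 T).const_smul (1 / T)

lemma periodAvg [CompleteSpace F] (hT : 0 < T) (hf : IsPeriodicC1 T f f') :
    IsPeriodicC1 T (fun x _ => periodAvg T f x) (fun x _ => _root_.periodAvg T f' x) where
  left := hf.left.periodAvg hT
  right := hf.right.periodAvg hT
  hasFDerivAt x _ := hf.periodAvg_hasFDerivAt x

lemma oscPrimitive [CompleteSpace F] (hT : 0 < T) (hf : IsPeriodicC1 T f f') :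
    IsPeriodicC1 T (oscPrimitive T f) (_root_.oscPrimitive T f') where
  left := hf.left.oscPrimitive hT
  right := hf.right.oscPrimitive hT
  hasFDerivAt x t := by
    have h := hf.sub (hf.periodAvg hT)
    exact hasFDerivAt_intervalIntegral_of_bounded h.left.cont h.right.cont h.right.bdd
      h.hasFDerivAt x 0 t

lemma norm_sub_le (hf : IsPeriodicC1 T f f') {B : ℝ} (hB : ∀ x t, ‖f' x t‖ ≤ B) (x y : X)
    (t : ℝ) : ‖f x t - f y t‖ ≤ B * ‖x - y‖ :=
  convex_univ.norm_image_sub_le_of_norm_hasFDerivWithin_le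
    (fun z _ => (hf.hasFDerivAt z t).hasFDerivWithinAt) (fun z _ => hB z t) (mem_univ y)
    (mem_univ x)

lemma hasDerivAt_comp_curve (hf : IsPeriodicC1 T f f') {ft : X → ℝ → F}
    (hft : Continuous (Function.uncurry ft)) (hd : ∀ x t, HasDerivAt (f x) (ft x t) t)
    {x : ℝ → X} {x' : X} {t : ℝ} (hx : HasDerivAt x x' t) :
    HasDerivAt (fun s => f (x s) s) (f' (x t) t x' + ft (x t) t) t := by
  have h := hasStrictFDerivAt_uncurry_coprod (𝕜 := ℝ) (u := (x t, t)) (f := f) (f₁ := f')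
    (f₂ := fun x t => (1 : ℝ →L[ℝ] ℝ).smulRight (ft x t))
    (Eventually.of_forall fun v => hf.hasFDerivAt v.1 v.2)
    (Eventually.of_forall fun v => (hd v.1 v.2).hasFDerivAt)
    hf.right.cont.continuousAt
    (by
      refine Continuous.continuousAt
        (f := fun p : X × ℝ => (1 : ℝ →L[ℝ] ℝ).smulRight (ft p.1 p.2)) ?_
      exact (ContinuousLinearMap.smulRightL ℝ ℝ F 1).continuous.comp hft)
  have h2 := HasFDerivAt.comp_hasDerivAt (f := fun s => (x s, s)) t h.hasFDerivAt
    (hx.prodMk (hasDerivAt_id t))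
  have e : f' (x t) t x' + ft (x t) t
      = (f' (x t) t).coprod ((1 : ℝ →L[ℝ] ℝ).smulRight (ft (x t) t)) (x', 1) := by simp
  rw [e]
  exact h2

end IsPeriodicC1

lemma isPeriodicC1_of_contDiff {T : ℝ} {f : X × ℝ → F} (hf : ContDiff ℝ 1 f)
    (hper : ∀ x t, f (x, t + T) = f (x, t)) (hb : ∃ B, ∀ p, ‖f p‖ ≤ B)
    (hb' : ∃ B, ∀ p, ‖fderiv ℝ f p‖ ≤ B) :
    IsPeriodicC1 T (fun x t => f (x, t))
      (fun x t => (fderiv ℝ f (x, t)).comp (ContinuousLinearMap.inl ℝ X ℝ)) := by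
  have hd (x : X) (t : ℝ) : HasFDerivAt (fun y => f (y, t))
      ((fderiv ℝ f (x, t)).comp (ContinuousLinearMap.inl ℝ X ℝ)) x :=
    ((hf.differentiable one_ne_zero) (x, t)).hasFDerivAt.comp x (hasFDerivAt_prodMk_left x t)
  refine ⟨⟨hf.continuous, hper, hb.imp fun B h x t => h _⟩, ⟨?_, fun x t => ?_, ?_⟩, hd⟩
  · exact (hf.continuous_fderiv one_ne_zero).clm_comp continuous_const
  · refine (hd x (t + T)).unique ?_
    simpa only [hper] using hd x t
  · obtain ⟨B, hB⟩ := hb'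
    refine ⟨B, fun x t => (ContinuousLinearMap.opNorm_comp_le _ _).trans ?_⟩
    calc _ ≤ B * 1 := by
          gcongr
          · exact (norm_nonneg _).trans (hB 0)
          · exact hB _
          · exact ContinuousLinearMap.norm_inl_le_one ℝ X ℝ
      _ = B := mul_one B

end Averaging

section GlobalExistence

variable {E : Type*} [NormedAddCommGroup E] [NormedSpace ℝ E] [CompleteSpace E]

/-- A bounded time-dependent vector field that is uniformly Lipschitz in space has global integral
curves. -/
lemma exists_global_solution {f : ℝ → E → E} {K : ℝ≥0} {B : ℝ} (hlip : ∀ t, LipschitzWith K (f t))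
    (hcont : ∀ x, Continuous fun t => f t x) (hB : ∀ t x, ‖f t x‖ ≤ B) (t₀ : ℝ) (x₀ : E) :
    ∃ α : ℝ → E, α t₀ = x₀ ∧ ∀ t, HasDerivAt α (f t (α t)) t := by
  have hB0 : 0 ≤ B := (norm_nonneg _).trans (hB 0 0)
  have key (N : ℕ) : ∃ α : ℝ → E, α t₀ = x₀ ∧
      ∀ t ∈ Ioo (t₀ - (N + 1)) (t₀ + (N + 1)), HasDerivAt α (f t (α t)) t := by
    have hPL : IsPicardLindelof f (tmin := t₀ - (N + 1)) (tmax := t₀ + (N + 1))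
        ⟨t₀, by constructor <;> linarith [N.cast_nonneg (α := ℝ)]⟩ x₀
        (B.toNNReal * (N + 1)) 0 B.toNNReal K :=
      { lipschitzOnWith := fun t _ => (hlip t).lipschitzOnWith
        continuousOn := fun x _ => (hcont x).continuousOn
        norm_le := fun t _ x _ => by simpa [hB0] using hB t x
        mul_max_le := by simp }
    obtain ⟨α, hα, hd⟩ := hPL.exists_eq_forall_mem_Icc_hasDerivWithinAt₀
    exact ⟨α, hα, fun t ht => (hd t (Ioo_subset_Icc_self ht)).hasDerivAt (Icc_mem_nhds ht.1 ht.2)⟩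
  choose α hα hd using key
  have hagree {M N : ℕ} (hMN : M ≤ N) :
      EqOn (α M) (α N) (Ioo (t₀ - (M + 1)) (t₀ + (M + 1))) := by
    have hMN' : (M : ℝ) ≤ N := by exact_mod_cast hMN
    refine ODE_solution_unique_of_mem_Ioo (v := f) (s := fun _ => univ) (K := K)
      (t₀ := t₀) (fun t _ => (hlip t).lipschitzOnWith)
      ⟨by linarith [M.cast_nonneg (α := ℝ)], by linarith [M.cast_nonneg (α := ℝ)]⟩
      (fun t ht => ⟨hd M t ht, mem_univ _⟩)
      (fun t ht => ⟨hd N t ⟨by linarith [ht.1], by linarith [ht.2]⟩, mem_univ _⟩) ?_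
    rw [hα, hα]
  have hmem (t : ℝ) : t ∈ Ioo (t₀ - (⌈|t - t₀|⌉₊ + 1)) (t₀ + (⌈|t - t₀|⌉₊ + 1)) := by
    have h1 := Nat.le_ceil |t - t₀|
    have h2 := abs_le.1 h1
    constructor <;> linarith
  refine ⟨fun t => α ⌈|t - t₀|⌉₊ t, by simp [hα], fun t => ?_⟩
  refine (hd _ t (hmem t)).congr_of_eventuallyEq ?_
  filter_upwards [isOpen_Ioo.mem_nhds (hmem t)] with s hs
  rcases le_total ⌈|s - t₀|⌉₊ ⌈|t - t₀|⌉₊ with h | h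
  · exact hagree h (hmem s)
  · exact (hagree h hs).symm

end GlobalExistence

lemma norm_sub_sub_fderiv_le {X Y : Type*} [NormedAddCommGroup X] [NormedSpace ℝ X]
    [NormedAddCommGroup Y] [NormedSpace ℝ Y] {G : X → Y} {D : X → X →L[ℝ] Y} {c R : ℝ}
    (hc : 0 ≤ c) (hD : ∀ x, HasFDerivAt G (D x) x) (hlip : ∀ x y, ‖D x - D y‖ ≤ c * ‖x - y‖)
    {w x y : X} (hx : ‖x - w‖ ≤ R) (hy : ‖y - w‖ ≤ R) :
    ‖G y - G x - D w (y - x)‖ ≤ c * R * ‖y - x‖ :=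
  (convex_closedBall w R).norm_image_sub_le_of_norm_hasFDerivWithin_le'
    (fun z _ => (hD z).hasFDerivWithinAt)
    (fun z hz => (hlip z w).trans (by gcongr; simpa [dist_eq_norm] using hz))
    (by simpa [dist_eq_norm] using hx) (by simpa [dist_eq_norm] using hy)

section Lyapunov

variable {E : Type*} [NormedAddCommGroup E] [InnerProductSpace ℝ E] [CompleteSpace E]

open NormedSpace in
/-- Exponential stability of an equilibrium makes the linearised flow a contraction at some positive
time. -/
lemma exists_norm_exp_fderiv_le {G : E → E} {D : E → E →L[ℝ] E} {c B : ℝ}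
    (hc : 0 ≤ c) (hD : ∀ x, HasFDerivAt G (D x) x) (hlip : ∀ x y, ‖D x - D y‖ ≤ c * ‖x - y‖)
    (hG : ∀ x, ‖G x‖ ≤ B) (hDB : ∀ x, ‖D x‖ ≤ B) (hG0 : G 0 = 0)
    (hstab : ∃ δ K lam : ℝ, 0 < δ ∧ 0 < K ∧ 0 < lam ∧
      ∀ (t₀ : ℝ) (z : ℝ → E), (∀ t ≥ t₀, HasDerivAt z (G (z t)) t) → ‖z t₀‖ ≤ δ →
        ∀ t ≥ t₀, ‖z t‖ ≤ K * Real.exp (-lam * (t - t₀)) * ‖z t₀‖) :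
    ∃ L : ℝ, 0 < L ∧ ‖exp (L • D 0)‖ ≤ 1 / 2 := by
  obtain ⟨δ, K, lam, hδ, hK, hlam, hst⟩ := hstab
  obtain ⟨L, hL, hKL⟩ : ∃ L : ℝ, 0 < L ∧ K * Real.exp (-lam * L) ≤ 1 / 4 := by
    have h1 : Tendsto (fun L : ℝ => K * Real.exp (-lam * L)) atTop (𝓝 (K * 0)) :=
      (Real.tendsto_exp_atBot.comp (tendsto_id.const_mul_atTop_of_neg (by linarith))).const_mul K
    rw [mul_zero] at h1
    obtain ⟨L, h2, h3⟩ := ((h1.eventually (ge_mem_nhds (by norm_num : (0:ℝ) < 1 / 4))).and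
      (eventually_gt_atTop 0)).exists
    exact ⟨L, h3, h2⟩
  refine ⟨L, hL, ?_⟩
  have hB0 : 0 ≤ B := (norm_nonneg _).trans (hG 0)
  have hGlip : LipschitzWith B.toNNReal G :=
    LipschitzWith.of_dist_le_mul fun x y => by
      rw [dist_eq_norm, dist_eq_norm, Real.coe_toNNReal _ hB0]
      exact convex_univ.norm_image_sub_le_of_norm_hasFDerivWithin_le
        (fun z _ => (hD z).hasFDerivWithinAt) (fun z _ => hDB z) (mem_univ y) (mem_univ x)
  have hquad (v : E) : ‖G v - D 0 v‖ ≤ c * ‖v‖ ^ 2 := by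
    have h := norm_sub_sub_fderiv_le hc hD hlip (w := 0) (x := 0) (y := v) (R := ‖v‖)
      (by simp) (by simp)
    simpa [hG0, sq, mul_assoc] using h
  set k : ℝ≥0 := ‖D 0‖₊ + 1 with hk
  set Q : ℝ := c * K ^ 2 / k * (Real.exp (k * L) - 1) with hQ
  have hk0 : (0 : ℝ) < k := by rw [hk]; positivity
  have hQ0 : 0 ≤ Q := by
    have : 1 ≤ Real.exp (k * L) := Real.one_le_exp (by positivity)
    have : 0 ≤ Real.exp (k * L) - 1 := by linarith
    positivity
  refine ContinuousLinearMap.opNorm_le_of_ball (ε := min δ (1 / (4 * (Q + 1))))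
    (by positivity) (by norm_num) fun v hv => ?_
  rw [mem_ball_zero_iff, lt_min_iff] at hv
  obtain ⟨z, hz0, hz⟩ := exists_global_solution (f := fun _ => G) (fun _ => hGlip)
    (fun _ => continuous_const) (fun _ => hG) 0 v
  have hdecay := hst 0 z (fun t _ => hz t) (by rw [hz0]; exact hv.1.le)
  rw [hz0] at hdecay
  have hexp (t : ℝ) : HasDerivAt (fun s : ℝ => exp (s • D 0) v) (D 0 (exp (t • D 0) v)) t := by
    have h := (hasDerivAt_exp_smul_const' (𝕂 := ℝ) (D 0) t).clm_apply (hasDerivAt_const t v)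
    simpa using h
  have hdist := dist_le_of_approx_trajectories_ODE (v := fun _ => D 0) (K := k)
    (f := z) (f' := fun t => G (z t)) (g := fun s : ℝ => exp (s • D 0) v)
    (g' := fun t => D 0 (exp (t • D 0) v)) (a := 0) (b := L) (εf := c * (K * ‖v‖) ^ 2)
    (εg := 0) (δ := 0)
    (fun _ => (D 0).lipschitz.weaken (by simp [hk]))
    (fun t _ => (hz t).continuousAt.continuousWithinAt) (fun t _ => (hz t).hasDerivWithinAt)
    (fun t ht => by
      rw [dist_eq_norm]
      refine (hquad _).trans ?_
      gcongr
      refine (hdecay t ht.1).trans ?_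
      have : Real.exp (-lam * (t - 0)) ≤ 1 := Real.exp_le_one_iff.2 (by nlinarith [ht.1])
      calc K * Real.exp (-lam * (t - 0)) * ‖v‖ ≤ K * 1 * ‖v‖ := by gcongr
        _ = K * ‖v‖ := by ring)
    (fun t _ => (hexp t).continuousAt.continuousWithinAt)
    (fun t _ => (hexp t).hasDerivWithinAt)
    (by simp) (by simp [hz0]) L ⟨hL.le, le_rfl⟩
  rw [gronwallBound_of_K_ne_0 hk0.ne', dist_eq_norm'] at hdist
  have h1 : ‖exp (L • D 0) v - z L‖ ≤ Q * ‖v‖ ^ 2 := by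
    refine hdist.trans_eq ?_
    rw [hQ]
    simp only [sub_zero, add_zero, zero_mul, zero_add]
    ring
  have h2 : ‖z L‖ ≤ 1 / 4 * ‖v‖ := by
    refine (hdecay L hL.le).trans ?_
    rw [sub_zero]
    gcongr
  have h3 : Q * ‖v‖ ≤ 1 / 4 := by
    have h4 := hv.2.le
    rw [le_div_iff₀ (by positivity)] at h4
    nlinarith [norm_nonneg v]
  calc ‖exp (L • D 0) v‖ ≤ ‖exp (L • D 0) v - z L‖ + ‖z L‖ := norm_le_norm_sub_add _ _
    _ ≤ Q * ‖v‖ ^ 2 + 1 / 4 * ‖v‖ := add_le_add h1 h2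
    _ = Q * ‖v‖ * ‖v‖ + 1 / 4 * ‖v‖ := by ring
    _ ≤ 1 / 4 * ‖v‖ + 1 / 4 * ‖v‖ := by gcongr
    _ = 1 / 2 * ‖v‖ := by ring

open NormedSpace InnerProductSpace in
/-- A linear map whose flow is a contraction at some positive time has a quadratic Lyapunov
function. -/
lemma exists_lyapunov_of_norm_exp_le {A : E →L[ℝ] E} {L : ℝ} (hL : 0 < L)
    (hA : ‖exp (L • A)‖ ≤ 1 / 2) :
    ∃ (P : E →L[ℝ] E) (m : ℝ), 0 < m ∧ (∀ v w, inner ℝ (P v) w = inner ℝ (P w) v) ∧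
      (∀ v, m * ‖v‖ ^ 2 ≤ inner ℝ (P v) v) ∧ ∀ v, 2 * inner ℝ (P v) (A v) ≤ -(3 / 4) * ‖v‖ ^ 2 := by
  let +nondep : NormedAlgebra ℚ (E →L[ℝ] E) := .restrictScalars ℚ ℝ _
  have hcexp : Continuous fun s : ℝ => exp (s • A) :=
    continuous_iff_continuousAt.2 fun s =>
      (hasDerivAt_exp_smul_const (𝕂 := ℝ) A s).continuousAt
  have hc : Continuous fun s : ℝ =>
      (ContinuousLinearMap.adjoint (exp (s • A))).comp (exp (s • A)) :=
    (ContinuousLinearMap.adjoint.continuous.comp hcexp).clm_comp hcexp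
  set P : E →L[ℝ] E := ∫ s in (0:ℝ)..L, (ContinuousLinearMap.adjoint (exp (s • A))).comp
    (exp (s • A)) with hP
  have hPapp (v w : E) : inner ℝ (P v) w
      = ∫ s in (0:ℝ)..L, inner ℝ (exp (s • A) v) (exp (s • A) w) := by
    have h1 := ContinuousLinearMap.intervalIntegral_comp_comm
      ((innerSL ℝ w).comp (ContinuousLinearMap.apply ℝ E v))
      (hc.intervalIntegrable (μ := volume) 0 L)
    rw [real_inner_comm]
    refine h1.symm.trans (intervalIntegral.integral_congr fun s _ => ?_)
    simp [ContinuousLinearMap.adjoint_inner_right, real_inner_comm]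
  obtain ⟨b, hb0, hb⟩ : ∃ b : ℝ, 0 < b ∧ ∀ s ∈ Icc 0 L, ‖exp (-(s • A))‖ ≤ b := by
    have hcneg : Continuous fun s : ℝ => exp (-(s • A)) := by
      simpa only [Function.comp_def, neg_smul] using hcexp.comp continuous_neg
    obtain ⟨b, hb⟩ := isCompact_Icc.exists_bound_of_continuousOn (s := Icc 0 L)
      hcneg.continuousOn
    exact ⟨max b 1, by positivity, fun s hs => (hb s hs).trans (le_max_left _ _)⟩
  refine ⟨P, L * b⁻¹ ^ 2, by positivity, fun v w => ?_, fun v => ?_, fun v => ?_⟩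
  · rw [hPapp, hPapp]
    simp_rw [real_inner_comm]
  · rw [hPapp]
    have hcv : Continuous fun s : ℝ => exp (s • A) v := hcexp.clm_apply continuous_const
    have h : ∀ s ∈ Icc 0 L, (b⁻¹ * ‖v‖) ^ 2
        ≤ inner ℝ (exp (s • A) v) (exp (s • A) v) := fun s hs => by
      rw [real_inner_self_eq_norm_sq]
      gcongr
      rw [inv_mul_le_iff₀ hb0]
      have h1 : exp (-(s • A)) (exp (s • A) v) = v := by
        have h2 : exp (-(s • A)) * exp (s • A) = 1 := by
          rw [← exp_add_of_commute ((Commute.refl (s • A)).neg_left), neg_add_cancel, exp_zero]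
        have h3 := congrArg (fun M : E →L[ℝ] E => M v) h2
        simpa using h3
      calc ‖v‖ = ‖exp (-(s • A)) (exp (s • A) v)‖ := by rw [h1]
        _ ≤ ‖exp (-(s • A))‖ * ‖exp (s • A) v‖ := ContinuousLinearMap.le_opNorm _ _
        _ ≤ b * ‖exp (s • A) v‖ := by
          gcongr
          exact hb s hs
    have h2 := intervalIntegral.integral_mono_on (μ := volume) hL.le
      intervalIntegrable_const ((hcv.inner hcv).intervalIntegrable 0 L) h
    rw [intervalIntegral.integral_const, sub_zero, smul_eq_mul] at h2
    calc _ = L * (b⁻¹ * ‖v‖) ^ 2 := by ring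
      _ ≤ _ := h2
  · have hexp (t : ℝ) : HasDerivAt (fun s : ℝ => exp (s • A) v) (exp (t • A) (A v)) t := by
      have h := (hasDerivAt_exp_smul_const (𝕂 := ℝ) A t).clm_apply (hasDerivAt_const t v)
      simpa using h
    have hcv (w : E) : Continuous fun s : ℝ => exp (s • A) w := hcexp.clm_apply continuous_const
    have hd (t : ℝ) := (hexp t).inner ℝ (hexp t)
    have h1 := intervalIntegral.integral_eq_sub_of_hasDerivAt (a := 0) (b := L)
      (fun t _ => hd t) ((((hcv v).inner (hcv (A v))).add
        ((hcv (A v)).inner (hcv v))).intervalIntegrable 0 L)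
    rw [intervalIntegral.integral_add (((hcv v).inner (hcv (A v))).intervalIntegrable 0 L)
      (((hcv (A v)).inner (hcv v)).intervalIntegrable 0 L), ← hPapp] at h1
    have h2 : ∫ s in (0:ℝ)..L, inner ℝ (exp (s • A) (A v)) (exp (s • A) v)
        = inner ℝ (P v) (A v) := by
      rw [hPapp]
      simp_rw [real_inner_comm]
    rw [h2] at h1
    have h3 : ‖exp (L • A) v‖ ≤ 1 / 2 * ‖v‖ :=
      (ContinuousLinearMap.le_opNorm _ _).trans (by gcongr)
    have h4 : inner ℝ (exp (L • A) v) (exp (L • A) v) ≤ 1 / 4 * ‖v‖ ^ 2 := by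
      rw [real_inner_self_eq_norm_sq]
      nlinarith [norm_nonneg (exp (L • A) v), norm_nonneg v]
    simp only [zero_smul, exp_zero, one_apply_eq_self] at h1
    rw [real_inner_self_eq_norm_sq v] at h1
    linarith

omit [CompleteSpace E] in
/-- Perturbations of a linear system with a quadratic Lyapunov function stay within a fixed multiple
of the size of their initial value and of the inhomogeneity. -/
lemma exists_norm_le_of_lyapunov {A P : E →L[ℝ] E} {m : ℝ} (hm : 0 < m)
    (hsymm : ∀ v w, inner ℝ (P v) w = inner ℝ (P w) v)
    (hpos : ∀ v, m * ‖v‖ ^ 2 ≤ inner ℝ (P v) v)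
    (hA : ∀ v, 2 * inner ℝ (P v) (A v) ≤ -(3 / 4) * ‖v‖ ^ 2) :
    ∃ κ C : ℝ, 0 < κ ∧ 1 ≤ C ∧ ∀ (ε r s t₀ : ℝ) (v g : ℝ → E), 0 < ε → 0 < s → C * s ≤ r →
      (∀ t ≥ t₀, HasDerivAt v (ε • (A (v t) + g t)) t) →
      (∀ t ≥ t₀, ‖v t‖ ≤ r → ‖g t‖ ≤ κ * ‖v t‖ + s) → ‖v t₀‖ ≤ s →
      ∀ t ≥ t₀, ‖v t‖ ≤ C * s := by
  set M : ℝ := ‖P‖ + 1 with hM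
  have hM0 : 0 < M := by positivity
  have hPM (v w : E) : inner ℝ (P v) w ≤ M * ‖v‖ * ‖w‖ := by
    refine (real_inner_le_norm _ _).trans ?_
    gcongr
    refine (P.le_opNorm v).trans ?_
    gcongr
    linarith
  set k : ℝ := 4 * M + 1 with hk
  set C : ℝ := max 1 (Real.sqrt (M * k ^ 2 / m)) with hC
  have hCsq : M * k ^ 2 ≤ m * C ^ 2 := by
    have h1 : Real.sqrt (M * k ^ 2 / m) ≤ C := le_max_right _ _
    have h2 : M * k ^ 2 / m ≤ C ^ 2 := by
      rw [← Real.sq_sqrt (by positivity : 0 ≤ M * k ^ 2 / m)]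
      gcongr
    rw [div_le_iff₀ hm] at h2
    linarith
  refine ⟨1 / (8 * M), C, by positivity, le_max_left _ _,
    fun ε r s t₀ v g hε hs hr hv hg hv0 t ht => ?_⟩
  have hC1 : 1 ≤ C := le_max_left _ _
  have hsub (w : E) (hw : inner ℝ (P w) w ≤ M * k ^ 2 * s ^ 2) : ‖w‖ ≤ C * s := by
    have h1 : m * ‖w‖ ^ 2 ≤ m * (C * s) ^ 2 := by
      calc _ ≤ M * k ^ 2 * s ^ 2 := (hpos w).trans hw
        _ ≤ m * C ^ 2 * s ^ 2 := by gcongr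
        _ = _ := by ring
    exact le_of_sq_le_sq (le_of_mul_le_mul_left h1 hm) (by positivity)
  refine hsub _ ?_
  have hd (t : ℝ) (ht : t ≥ t₀) : HasDerivAt (fun t => inner ℝ (P (v t)) (v t))
      (ε * (2 * inner ℝ (P (v t)) (A (v t)) + 2 * inner ℝ (P (v t)) (g t))) t := by
    have h1 := ((P.hasFDerivAt.comp_hasDerivAt t (hv t ht)).inner ℝ (hv t ht))
    refine h1.congr_deriv ?_
    rw [hsymm (ε • _)]
    simp only [inner_smul_right, inner_add_right, Function.comp]
    ring
  refine image_le_of_deriv_right_lt_deriv_boundary (a := t₀) (b := t)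
    (f := fun t => inner ℝ (P (v t)) (v t)) (B := fun _ => M * k ^ 2 * s ^ 2) (B' := fun _ => 0)
    (fun x hx => (hd x hx.1).continuousAt.continuousWithinAt)
    (fun x hx => (hd x hx.1).hasDerivWithinAt) ?_ (fun x => hasDerivAt_const x _) ?_ ⟨ht, le_rfl⟩
  · calc _ ≤ M * ‖v t₀‖ * ‖v t₀‖ := hPM _ _
      _ ≤ M * s * s := by gcongr
      _ = M * 1 ^ 2 * s ^ 2 := by ring
      _ ≤ M * k ^ 2 * s ^ 2 := by gcongr; linarith
  · intro x hx hxe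
    have h1 : k * s ≤ ‖v x‖ := by
      have h2 : M * (k * s) ^ 2 ≤ M * ‖v x‖ ^ 2 := by
        have := hPM (v x) (v x)
        rw [hxe] at this
        linarith
      exact le_of_sq_le_sq (le_of_mul_le_mul_left h2 hM0) (norm_nonneg _)
    have h3 := hg x hx.1 ((hsub _ hxe.le).trans hr)
    have h4 := hPM (v x) (g x)
    have h5 := hA (v x)
    have hvx : 0 < ‖v x‖ := lt_of_lt_of_le (by positivity) h1
    have h6 : M * ‖v x‖ * ‖g x‖ < 3 / 8 * ‖v x‖ ^ 2 := by
      have h7 : M * ‖g x‖ < 3 / 8 * ‖v x‖ := by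
        calc M * ‖g x‖ ≤ M * (1 / (8 * M) * ‖v x‖ + s) := by gcongr
          _ = 1 / 8 * ‖v x‖ + M * s := by field_simp
          _ < 3 / 8 * ‖v x‖ := by nlinarith
      nlinarith
    exact mul_neg_of_pos_of_neg hε (by linarith)

end Lyapunov

section UniformEstimate

variable {E : Type*} [NormedAddCommGroup E] [InnerProductSpace ℝ E] [CompleteSpace E]

/-- Near an exponentially stable equilibrium of `G`, solutions of `ż = ε G(z) + ε² H(z)` persist
under perturbations of size `ε³` of the field and `ε²` of the initial value, uniformly in time. -/
lemma exists_norm_sub_le_of_expStable {G H : E → E} {D : E → E →L[ℝ] E} {c B l C₁ : ℝ}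
    (hc : 0 ≤ c) (hD : ∀ x, HasFDerivAt G (D x) x) (hlip : ∀ x y, ‖D x - D y‖ ≤ c * ‖x - y‖)
    (hG : ∀ x, ‖G x‖ ≤ B) (hDB : ∀ x, ‖D x‖ ≤ B) (hG0 : G 0 = 0)
    (hstab : ∃ δ K lam : ℝ, 0 < δ ∧ 0 < K ∧ 0 < lam ∧
      ∀ (t₀ : ℝ) (z : ℝ → E), (∀ t ≥ t₀, HasDerivAt z (G (z t)) t) → ‖z t₀‖ ≤ δ →
        ∀ t ≥ t₀, ‖z t‖ ≤ K * Real.exp (-lam * (t - t₀)) * ‖z t₀‖)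
    (hl : 0 ≤ l) (hHB : ∀ x, ‖H x‖ ≤ B) (hHl : ∀ x y, ‖H x - H y‖ ≤ l * ‖x - y‖) (hC₁ : 0 ≤ C₁) :
    ∃ ρ ε₀ C : ℝ, 0 < ρ ∧ 0 < ε₀ ∧ 0 < C ∧ ∀ (ε t₀ : ℝ) (z u q : ℝ → E), 0 < ε → ε < ε₀ →
      (∀ t ≥ t₀, HasDerivAt z (ε • G (z t) + ε ^ 2 • H (z t)) t) →
      (∀ t ≥ t₀, HasDerivAt u (ε • G (u t) + ε ^ 2 • H (u t) + q t) t) →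
      (∀ t ≥ t₀, ‖q t‖ ≤ C₁ * ε ^ 3) → ‖z t₀‖ ≤ ρ → ‖u t₀ - z t₀‖ ≤ C₁ * ε ^ 2 →
      ∀ t ≥ t₀, ‖u t - z t‖ ≤ C * ε ^ 2 := by
  obtain ⟨L, hL, hexp⟩ := exists_norm_exp_fderiv_le hc hD hlip hG hDB hG0 hstab
  obtain ⟨P, m, hm, hsymm, hpos, hPA⟩ := exists_lyapunov_of_norm_exp_le hL hexp
  obtain ⟨κ, C₀, hκ, hC₀, htrap⟩ := exists_norm_le_of_lyapunov hm hsymm hpos hPA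
  have hB0 : 0 ≤ B := (norm_nonneg _).trans (hG 0)
  set r : ℝ := κ / (2 * (c + 1)) with hr
  have hr0 : 0 < r := by positivity
  set ρ : ℝ := r / (2 * C₀) with hρ
  have hρ0 : 0 < ρ := by positivity
  have hCρ : C₀ * (2 * ρ) = r := by rw [hρ]; field_simp
  have hcr : c * r ≤ κ / 2 := by
    rw [hr, ← mul_div_assoc, div_le_div_iff₀ (by positivity) (by norm_num)]
    nlinarith
  set S : ℝ := B + C₁ + l + 1 with hS
  have hS0 : 0 < S := by positivity
  refine ⟨ρ, min 1 (min (ρ / S) (κ / (2 * S))), C₀ * S, hρ0, by positivity, by positivity, ?_⟩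
  intro ε t₀ z u q hε hε₀ hz hu hq hz0 hu0
  have hε1 : ε ≤ 1 := hε₀.le.trans (min_le_left _ _)
  have hερ : ε * S ≤ ρ := (le_div_iff₀ hS0).1
    (hε₀.le.trans ((min_le_right _ _).trans (min_le_left _ _)))
  have hεκ : ε * S ≤ κ / 2 := by
    have h := (le_div_iff₀ (by positivity)).1
      (hε₀.le.trans ((min_le_right _ _).trans (min_le_right _ _)))
    linarith
  have hε2 : ε ^ 2 ≤ ε := by nlinarith
  have hq' (t : ℝ) (ht : t ≥ t₀) : ‖ε⁻¹ • q t‖ ≤ C₁ * ε ^ 2 := by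
    rw [norm_smul, norm_inv, Real.norm_of_nonneg hε.le, inv_mul_le_iff₀ hε]
    exact (hq t ht).trans_eq (by ring)
  have hball (y p : ℝ → E) (hy : ∀ t ≥ t₀, HasDerivAt y (ε • G (y t) + ε ^ 2 • H (y t) + p t) t)
      (hp : ∀ t ≥ t₀, ‖ε⁻¹ • p t‖ ≤ C₁ * ε ^ 2) (hy0 : ‖y t₀‖ ≤ 2 * ρ) :
      ∀ t ≥ t₀, ‖y t‖ ≤ r := by
    intro t ht
    rw [← hCρ]
    refine htrap ε r (2 * ρ) t₀ y (fun t => (G (y t) - D 0 (y t)) + ε • H (y t) + ε⁻¹ • p t)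
      hε (by positivity) hCρ.le (fun t ht => ?_) (fun t ht hyr => ?_) hy0 t ht
    · convert hy t ht using 1
      simp only [smul_add, smul_sub, smul_smul, mul_inv_cancel₀ hε.ne', one_smul, sq]
      abel
    · have h1 := norm_sub_sub_fderiv_le hc hD hlip (w := 0) (x := 0) (y := y t) (R := r)
        (by simpa using hr0.le) (by simpa using hyr)
      rw [hG0, sub_zero, sub_zero] at h1
      have h2 : ‖ε • H (y t)‖ ≤ ε * B := by
        rw [norm_smul, Real.norm_of_nonneg hε.le]
        gcongr
        exact hHB _
      have h3 : c * r * ‖y t‖ ≤ κ * ‖y t‖ := by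
        gcongr
        linarith
      have h4 : C₁ * ε ^ 2 ≤ C₁ * ε := by gcongr
      have h5 : ε * B + C₁ * ε ≤ ε * S := by rw [hS]; nlinarith
      refine (norm_add₃_le).trans ?_
      linarith [hp t ht]
  have hzr := hball z 0 (by simpa using hz) (fun t _ => by simp; positivity) (by linarith)
  have hSε : C₁ * ε ^ 2 ≤ S * ε ^ 2 := by
    gcongr
    linarith
  have hur := hball u q hu hq' (by
    have h1 : S * ε ^ 2 ≤ S * ε := by gcongr
    have h2 := norm_le_norm_add_norm_sub' (u t₀) (z t₀)
    linarith)
  intro t ht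
  rw [mul_assoc]
  refine htrap ε (C₀ * (S * ε ^ 2)) (S * ε ^ 2) t₀ (fun t => u t - z t)
    (fun t => (G (u t) - G (z t) - D 0 (u t - z t)) + ε • (H (u t) - H (z t)) + ε⁻¹ • q t)
    hε (by positivity) le_rfl (fun t ht => ?_) (fun t ht _ => ?_) (hu0.trans hSε) t ht
  · refine ((hu t ht).sub (hz t ht)).congr_deriv ?_
    simp only [smul_add, smul_sub, smul_smul, mul_inv_cancel₀ hε.ne', one_smul, sq]
    abel
  · have h1 := norm_sub_sub_fderiv_le hc hD hlip (w := 0) (x := z t) (y := u t) (R := r)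
      (by simpa using hzr t ht) (by simpa using hur t ht)
    have h2 : ‖ε • (H (u t) - H (z t))‖ ≤ ε * S * ‖u t - z t‖ := by
      rw [norm_smul, Real.norm_of_nonneg hε.le, mul_assoc]
      gcongr
      refine (hHl _ _).trans ?_
      gcongr
      linarith
    have h3 : c * r * ‖u t - z t‖ ≤ κ / 2 * ‖u t - z t‖ := by gcongr
    have h4 : ε * S * ‖u t - z t‖ ≤ κ / 2 * ‖u t - z t‖ := by gcongr
    refine (norm_add₃_le).trans ?_
    linarith [hq' t ht]

end UniformEstimate

section NearIdentity

variable {X F G : Type*} [NormedAddCommGroup X] [NormedSpace ℝ X] [NormedAddCommGroup F]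
  [NormedSpace ℝ F]

/-- The primitive of mean zero of the oscillating part of `f x`. -/
noncomputable def meanFreePrimitive (T : ℝ) (f : X → ℝ → F) (x : X) (t : ℝ) : F :=
  oscPrimitive T f x t - periodAvg T (oscPrimitive T f) x

/-- The time-dependent field whose mean is the second-order averaged field. -/
noncomputable def secondOrderField (T : ℝ) (F₁ F₂ : X → ℝ → X) (A : X → ℝ → X →L[ℝ] X)
    (x : X) (t : ℝ) : X :=
  F₂ x t + A x t (meanFreePrimitive T F₁ x t) - meanFreePrimitive T A x t (periodAvg T F₁ x)

omit [NormedSpace ℝ X] in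
lemma IsPeriodicBdd.hasDerivAt_meanFreePrimitive [CompleteSpace F] {T : ℝ} {f : X → ℝ → F}
    (hf : IsPeriodicBdd T f) (x : X) (t : ℝ) :
    HasDerivAt (meanFreePrimitive T f x) (f x t - _root_.periodAvg T f x) t :=
  (hf.hasDerivAt_oscPrimitive x t).sub_const _

namespace IsPeriodicC1

variable {T : ℝ} {f : X → ℝ → F} {f' : X → ℝ → X →L[ℝ] F}

lemma meanFreePrimitive [CompleteSpace F] (hT : 0 < T) (hf : IsPeriodicC1 T f f') :
    IsPeriodicC1 T (meanFreePrimitive T f) (_root_.meanFreePrimitive T f') :=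
  (hf.oscPrimitive hT).sub ((hf.oscPrimitive hT).periodAvg hT)

lemma exists_secondOrderField [CompleteSpace X] (hT : 0 < T) {F₁ F₂ : X → ℝ → X}
    {A A₂ : X → ℝ → X →L[ℝ] X} {A' : X → ℝ → X →L[ℝ] X →L[ℝ] X} (h₁ : IsPeriodicC1 T F₁ A)
    (hA : IsPeriodicC1 T A A') (h₂ : IsPeriodicC1 T F₂ A₂) :
    ∃ K', IsPeriodicC1 T (secondOrderField T F₁ F₂ A) K' :=
  ⟨_, (h₂.add (hA.clm_apply (h₁.meanFreePrimitive hT))).sub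
    ((hA.meanFreePrimitive hT).clm_apply (h₁.periodAvg hT))⟩

lemma const_smul (hf : IsPeriodicC1 T f f') (a : ℝ) :
    IsPeriodicC1 T (fun x t => a • f x t) (fun x t => a • f' x t) where
  left := hf.left.bilin (ContinuousLinearMap.lsmul ℝ ℝ : ℝ →L[ℝ] F →L[ℝ] F).flip
    (g := fun _ _ => a) ⟨continuous_const, fun _ _ => rfl, ‖a‖, fun _ _ => le_rfl⟩
  right := hf.right.bilin (ContinuousLinearMap.lsmul ℝ ℝ : ℝ →L[ℝ] (X →L[ℝ] F) →L[ℝ] _).flip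
    (g := fun _ _ => a) ⟨continuous_const, fun _ _ => rfl, ‖a‖, fun _ _ => le_rfl⟩
  hasFDerivAt x t := (hf.hasFDerivAt x t).const_smul a

lemma exists_solution [CompleteSpace X] {f : X → ℝ → X} {f' : X → ℝ → X →L[ℝ] X}
    (hf : IsPeriodicC1 T f f') (t₀ : ℝ) (x₀ : X) :
    ∃ x : ℝ → X, x t₀ = x₀ ∧ ∀ t, HasDerivAt x (f (x t) t) t := by
  obtain ⟨B, hB⟩ := hf.left.bdd
  obtain ⟨K, hK⟩ := hf.right.bdd
  have hK0 : 0 ≤ K := (norm_nonneg _).trans (hK 0 0)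
  exact exists_global_solution (f := fun t x => f x t) (K := ⟨K, hK0⟩)
    (fun t => LipschitzWith.of_dist_le_mul fun x y => by
      rw [dist_eq_norm, dist_eq_norm]
      exact hf.norm_sub_le hK x y t)
    hf.left.continuous_right (fun t x => hB x t) t₀ x₀

/-- The second-order near-identity transformation: solutions of `ẋ = ε F₁(x, t) + ε² F₂(x, t)`
follow, up to `ε²`, functions solving the second-order averaged system up to an error `ε³`. -/
lemma exists_nearIdentity [CompleteSpace X] (hT : 0 < T) {F₁ F₂ : X → ℝ → X}
    {A A₂ : X → ℝ → X →L[ℝ] X} {A' : X → ℝ → X →L[ℝ] X →L[ℝ] X} (h₁ : IsPeriodicC1 T F₁ A)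
    (hA : IsPeriodicC1 T A A') (h₂ : IsPeriodicC1 T F₂ A₂) :
    ∃ C, 0 < C ∧ ∀ (ε t₀ : ℝ) (x : ℝ → X), 0 < ε → ε ≤ 1 →
      (∀ t ≥ t₀, HasDerivAt x (ε • F₁ (x t) t + ε ^ 2 • F₂ (x t) t) t) →
      ∃ u q : ℝ → X,
        (∀ t ≥ t₀, HasDerivAt u (ε • _root_.periodAvg T F₁ (u t)
          + ε ^ 2 • _root_.periodAvg T (secondOrderField T F₁ F₂ A) (u t) + q t) t) ∧
        (∀ t ≥ t₀, ‖q t‖ ≤ C * ε ^ 3) ∧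
        ∀ t, ‖x t - u t - ε • _root_.meanFreePrimitive T F₁ (x t) t‖ ≤ C * ε ^ 2 := by
  obtain ⟨K', hK⟩ := exists_secondOrderField hT h₁ hA h₂
  have hG := h₁.periodAvg hT
  have hD := hA.periodAvg hT
  have hG₂ := hK.periodAvg hT
  have hψ := h₁.meanFreePrimitive hT
  have hJ := hA.meanFreePrimitive hT
  have hJψ := hJ.clm_apply hψ
  have hχ := hJψ.sub (hK.oscPrimitive hT)
  set G := _root_.periodAvg T F₁ with hGdef
  set D := _root_.periodAvg T A
  set K₂ := secondOrderField T F₁ F₂ A with hK₂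
  set G₂ := _root_.periodAvg T K₂
  set ψ := _root_.meanFreePrimitive T F₁ with hψdef
  set J := _root_.meanFreePrimitive T A with hJdef
  set χ := fun x t => J x t (ψ x t) - _root_.oscPrimitive T K₂ x t
  set χ' := fun x t => ((J x t).comp (J x t) + (_root_.meanFreePrimitive T A' x t).flip (ψ x t))
    - _root_.oscPrimitive T K' x t
  obtain ⟨b₁, hb₁⟩ := h₁.left.bdd
  obtain ⟨b₂, hb₂⟩ := h₂.left.bdd
  obtain ⟨bψ, hbψ⟩ := hψ.left.bdd
  obtain ⟨bχ, hbχ⟩ := hχ.left.bdd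
  obtain ⟨bχd, hbχd⟩ := hχ.right.bdd
  obtain ⟨bJ, hbJ⟩ := hJ.left.bdd
  obtain ⟨bD, hbD⟩ := hD.left.bdd
  obtain ⟨c, hc⟩ := hD.right.bdd
  obtain ⟨l, hl⟩ := hG₂.right.bdd
  have hb₁0 := (norm_nonneg _).trans (hb₁ 0 0)
  have hb₂0 := (norm_nonneg _).trans (hb₂ 0 0)
  have hbψ0 := (norm_nonneg _).trans (hbψ 0 0)
  have hbχ0 := (norm_nonneg _).trans (hbχ 0 0)
  have hbχd0 := (norm_nonneg _).trans (hbχd 0 0)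
  have hbJ0 := (norm_nonneg _).trans (hbJ 0 0)
  have hbD0 := (norm_nonneg _).trans (hbD 0 0)
  have hc0 := (norm_nonneg _).trans (hc 0 0)
  have hl0 := (norm_nonneg _).trans (hl 0 0)
  set b := bψ + bχ with hb
  set χt := fun x t => A x t (ψ x t) - D x (ψ x t) + J x t (F₁ x t - G x) - (K₂ x t - G₂ x)
    with hχt
  have hψt (x : X) (t : ℝ) : HasDerivAt (ψ x) (F₁ x t - G x) t :=
    h₁.left.hasDerivAt_meanFreePrimitive x t
  have hχd (x : X) (t : ℝ) : HasDerivAt (χ x) (χt x t) t := by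
    have h := ((hA.left.hasDerivAt_meanFreePrimitive x t).clm_apply (hψt x t)).sub
      (hK.left.hasDerivAt_oscPrimitive x t)
    exact h
  have hχtc : Continuous (Function.uncurry χt) :=
    (((hA.clm_apply hψ).sub (hD.clm_apply hψ)).add (hJ.clm_apply (h₁.sub hG))).left.cont.sub
      (hK.sub hG₂).left.cont
  have hχt' (x : X) (t : ℝ) : χt x t = J x t (F₁ x t) - D x (ψ x t) - F₂ x t + G₂ x := by
    simp only [hχt, hK₂, secondOrderField, map_sub, ← hψdef, ← hJdef, ← hGdef]
    abel
  refine ⟨c * b ^ 2 + bD * bχ + l * b + bχd * (b₁ + b₂) + bJ * b₂ + bχ + 1, by positivity, ?_⟩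
  intro ε t₀ x hε hε1 hx
  have hε2 : ε ^ 2 ≤ ε := by nlinarith
  set u := fun t => x t - ε • ψ (x t) t + ε ^ 2 • χ (x t) t with hu
  have hux (t : ℝ) : u t - x t = -(ε • ψ (x t) t) + ε ^ 2 • χ (x t) t := by
    simp only [hu]; abel
  have hub (t : ℝ) : ‖u t - x t‖ ≤ ε * b := by
    rw [hux]
    refine (norm_add_le _ _).trans ?_
    rw [norm_neg, norm_smul, norm_smul, Real.norm_of_nonneg hε.le,
      Real.norm_of_nonneg (by positivity), hb, mul_add]
    gcongr
    exacts [hbψ _ _, hbχ _ _]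
  refine ⟨u, fun t => -(ε • (G (u t) - G (x t) - D (x t) (u t - x t)))
    - ε ^ 3 • D (x t) (χ (x t) t) + ε ^ 2 • (G₂ (x t) - G₂ (u t))
    + ε ^ 3 • (χ' (x t) t (F₁ (x t) t + ε • F₂ (x t) t) - J (x t) t (F₂ (x t) t)),
    fun t ht => ?_, fun t _ => ?_, fun t => ?_⟩
  · have h1 := hψ.hasDerivAt_comp_curve (h₁.sub hG).left.cont hψt (hx t ht)
    have h2 := hχ.hasDerivAt_comp_curve hχtc hχd (hx t ht)
    refine (((hx t ht).sub (h1.const_smul ε)).add (h2.const_smul (ε ^ 2))).congr_deriv ?_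
    beta_reduce
    rw [hχt', hux]
    simp only [map_add, map_smul, map_neg, hJdef]
    module
  · have e1 : ‖G (u t) - G (x t) - D (x t) (u t - x t)‖ ≤ c * (ε * b) * (ε * b) := by
      refine (norm_sub_sub_fderiv_le hc0 (fun y => hG.hasFDerivAt y 0)
        (fun y z => hD.norm_sub_le hc y z 0) (w := x t) (x := x t) (R := ε * b)
        (by simp; positivity) (hub t)).trans ?_
      gcongr
      exact hub t
    have e2 : ‖D (x t) (χ (x t) t)‖ ≤ bD * bχ :=
      ContinuousLinearMap.le_of_opNorm_le_of_le _ (hbD _ 0) (hbχ _ _)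
    have e3 : ‖G₂ (x t) - G₂ (u t)‖ ≤ l * (ε * b) := by
      refine (hG₂.norm_sub_le hl _ _ 0).trans ?_
      rw [norm_sub_rev]
      gcongr
      exact hub t
    have e4 : ‖F₁ (x t) t + ε • F₂ (x t) t‖ ≤ b₁ + b₂ := by
      refine (norm_add_le _ _).trans ?_
      rw [norm_smul, Real.norm_of_nonneg hε.le]
      have := mul_le_mul hε1 (hb₂ (x t) t) (norm_nonneg _) zero_le_one
      linarith [hb₁ (x t) t]
    have e5 : ‖χ' (x t) t (F₁ (x t) t + ε • F₂ (x t) t)‖ ≤ bχd * (b₁ + b₂) :=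
      ContinuousLinearMap.le_of_opNorm_le_of_le _ (hbχd _ _) e4
    have e6 : ‖J (x t) t (F₂ (x t) t)‖ ≤ bJ * b₂ :=
      ContinuousLinearMap.le_of_opNorm_le_of_le _ (hbJ _ _) (hb₂ _ _)
    have e7 := (_root_.norm_sub_le (χ' (x t) t (F₁ (x t) t + ε • F₂ (x t) t))
      (J (x t) t (F₂ (x t) t))).trans (add_le_add e5 e6)
    refine (norm_add_le _ _).trans ((add_le_add ((norm_add_le _ _).trans (add_le_add
      (_root_.norm_sub_le _ _) le_rfl)) le_rfl).trans ?_)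
    simp only [norm_neg, norm_smul, norm_pow, Real.norm_of_nonneg hε.le]
    calc _ ≤ ε * (c * (ε * b) * (ε * b)) + ε ^ 3 * (bD * bχ) + ε ^ 2 * (l * (ε * b))
          + ε ^ 3 * (bχd * (b₁ + b₂) + bJ * b₂) := by gcongr
      _ = (c * b ^ 2 + bD * bχ + l * b + bχd * (b₁ + b₂) + bJ * b₂) * ε ^ 3 := by ring
      _ ≤ _ := mul_le_mul_of_nonneg_right (by linarith) (by positivity)
  · have e : x t - u t - ε • ψ (x t) t = -(ε ^ 2 • χ (x t) t) := by
      simp only [hu]; abel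
    rw [e, norm_neg, norm_smul, Real.norm_of_nonneg (by positivity), mul_comm]
    gcongr
    refine (hbχ _ _).trans ?_
    have : 0 ≤ c * b ^ 2 + bD * bχ + l * b + bχd * (b₁ + b₂) + bJ * b₂ := by positivity
    linarith

end IsPeriodicC1

end NearIdentity

/-- Second-order averaging near an exponentially stable equilibrium of the averaged system. -/
lemma exists_second_order_averaging_estimate {E : Type*} [NormedAddCommGroup E]
    [InnerProductSpace ℝ E] [CompleteSpace E] {T : ℝ} (hT : 0 < T) {F₁ F₂ : E → ℝ → E}
    {A A₂ : E → ℝ → E →L[ℝ] E} {A' : E → ℝ → E →L[ℝ] E →L[ℝ] E} (h₁ : IsPeriodicC1 T F₁ A)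
    (hA : IsPeriodicC1 T A A') (h₂ : IsPeriodicC1 T F₂ A₂) (hG0 : periodAvg T F₁ 0 = 0)
    (hstab : ∃ δ K lam : ℝ, 0 < δ ∧ 0 < K ∧ 0 < lam ∧
      ∀ (t₀ : ℝ) (z : ℝ → E), (∀ t ≥ t₀, HasDerivAt z (periodAvg T F₁ (z t)) t) → ‖z t₀‖ ≤ δ →
        ∀ t ≥ t₀, ‖z t‖ ≤ K * Real.exp (-lam * (t - t₀)) * ‖z t₀‖) :
    ∃ ρ ε₀ C : ℝ, 0 < ρ ∧ 0 < ε₀ ∧ 0 < C ∧ ∀ (ε t₀ : ℝ) (z x : ℝ → E), 0 < ε → ε < ε₀ →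
      ‖z t₀‖ ≤ ρ →
      (∀ t ≥ t₀, HasDerivAt z (ε • periodAvg T F₁ (z t)
        + ε ^ 2 • periodAvg T (secondOrderField T F₁ F₂ A) (z t)) t) →
      x t₀ = z t₀ + ε • meanFreePrimitive T F₁ (z t₀) t₀ →
      (∀ t ≥ t₀, HasDerivAt x (ε • F₁ (x t) t + ε ^ 2 • F₂ (x t) t) t) →
      ∀ t ≥ t₀, ‖x t - z t - ε • meanFreePrimitive T F₁ (z t) t‖ < C * ε ^ 2 := by
  obtain ⟨K', hK⟩ := IsPeriodicC1.exists_secondOrderField hT h₁ hA h₂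
  obtain ⟨C₁, hC₁, hnear⟩ := IsPeriodicC1.exists_nearIdentity hT h₁ hA h₂
  have hG := h₁.periodAvg hT
  have hD := hA.periodAvg hT
  have hG₂ := hK.periodAvg hT
  have hψ := h₁.meanFreePrimitive hT
  obtain ⟨B, hB⟩ := hG.left.bdd
  obtain ⟨BD, hBD⟩ := hG.right.bdd
  obtain ⟨c, hc⟩ := hD.right.bdd
  obtain ⟨B₂, hB₂⟩ := hG₂.left.bdd
  obtain ⟨l, hl⟩ := hG₂.right.bdd
  obtain ⟨bψ, hbψ⟩ := hψ.left.bdd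
  obtain ⟨bJ, hbJ⟩ := hψ.right.bdd
  have hbψ0 := (norm_nonneg _).trans (hbψ 0 0)
  have hbJ0 := (norm_nonneg _).trans (hbJ 0 0)
  set G := periodAvg T F₁
  set G₂ := periodAvg T (secondOrderField T F₁ F₂ A)
  set ψ := meanFreePrimitive T F₁
  obtain ⟨ρ, ε₀, C, hρ, hε₀, hC, hest⟩ := exists_norm_sub_le_of_expStable (C₁ := C₁ + bJ * bψ)
    (B := max (max B BD) B₂) ((norm_nonneg _).trans (hc 0 0)) (fun x => hG.hasFDerivAt x 0)
    (fun x y => hD.norm_sub_le hc x y 0)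
    (fun x => (hB x 0).trans ((le_max_left _ _).trans (le_max_left _ _)))
    (fun x => (hBD x 0).trans ((le_max_right _ _).trans (le_max_left _ _))) hG0 hstab
    ((norm_nonneg _).trans (hl 0 0)) (fun x => (hB₂ x 0).trans (le_max_right _ _))
    (fun x y => hG₂.norm_sub_le hl x y 0) (by positivity)
  refine ⟨ρ, min ε₀ 1, (C₁ + C) + bJ * (C₁ + C + bψ) + 1, hρ, by positivity, by positivity, ?_⟩
  intro ε t₀ z x hε hεlt hz0 hz hx0 hx t ht
  have hε1 : ε ≤ 1 := hεlt.le.trans (min_le_right _ _)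
  have hε2 : ε ^ 2 ≤ ε := by nlinarith
  obtain ⟨u, q, hu, hq, hux⟩ := hnear ε t₀ x hε hε1 hx
  have hnorm (v : E) : ‖ε • v‖ = ε * ‖v‖ := by rw [norm_smul, Real.norm_of_nonneg hε.le]
  have hu0 : ‖u t₀ - z t₀‖ ≤ (C₁ + bJ * bψ) * ε ^ 2 := by
    have e : u t₀ - z t₀ = -(x t₀ - u t₀ - ε • ψ (x t₀) t₀)
        + ε • (ψ (z t₀) t₀ - ψ (x t₀) t₀) := by
      rw [smul_sub, hx0]
      abel
    have h1 : ‖z t₀ - x t₀‖ ≤ ε * bψ := by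
      rw [norm_sub_rev, hx0, add_sub_cancel_left, hnorm]
      gcongr
      exact hbψ _ _
    rw [e]
    refine (norm_add_le _ _).trans ?_
    rw [norm_neg, hnorm]
    calc _ ≤ C₁ * ε ^ 2 + ε * (bJ * (ε * bψ)) := by
          gcongr
          · exact hux t₀
          · exact (hψ.norm_sub_le hbJ _ _ _).trans (by gcongr)
      _ = _ := by ring
  have hzu := hest ε t₀ z u q hε (hεlt.trans_le (min_le_left _ _)) hz hu
    (fun s hs => (hq s hs).trans (by gcongr; linarith [mul_nonneg hbJ0 hbψ0])) hz0 hu0 t ht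
  have h1 : ‖x t - z t - ε • ψ (x t) t‖ ≤ (C₁ + C) * ε ^ 2 := by
    rw [show x t - z t - ε • ψ (x t) t = (x t - u t - ε • ψ (x t) t) + (u t - z t) by abel]
    refine (norm_add_le _ _).trans ?_
    rw [add_mul]
    exact add_le_add (hux t) hzu
  have h2 : ‖x t - z t‖ ≤ (C₁ + C + bψ) * ε := by
    rw [show x t - z t = (x t - z t - ε • ψ (x t) t) + ε • ψ (x t) t by abel]
    refine (norm_add_le _ _).trans ?_
    rw [hnorm]
    calc _ ≤ (C₁ + C) * ε + ε * bψ :=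
          add_le_add (h1.trans (by gcongr)) (by gcongr; exact hbψ _ _)
      _ = _ := by ring
  rw [show x t - z t - ε • ψ (z t) t
    = (x t - z t - ε • ψ (x t) t) + ε • (ψ (x t) t - ψ (z t) t) by rw [smul_sub]; abel]
  calc _ ≤ (C₁ + C) * ε ^ 2 + ε * (bJ * ((C₁ + C + bψ) * ε)) := by
        refine (norm_add_le _ _).trans (add_le_add h1 ?_)
        rw [hnorm]
        gcongr
        exact (hψ.norm_sub_le hbJ _ _ _).trans (by gcongr)
    _ < (C₁ + C) * ε ^ 2 + ε * (bJ * ((C₁ + C + bψ) * ε)) + ε ^ 2 :=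
        lt_add_of_pos_right _ (by positivity)
    _ = _ := by ring

lemma exists_norm_fderiv_clm_comp_le {X F G : Type*} [NormedAddCommGroup X] [NormedSpace ℝ X]
    [NormedAddCommGroup F] [NormedSpace ℝ F] [NormedAddCommGroup G] [NormedSpace ℝ G]
    {f : X → F} (hf : Differentiable ℝ f) (L : F →L[ℝ] G) (hb : ∃ B, ∀ p, ‖fderiv ℝ f p‖ ≤ B) :
    ∃ B, ∀ p, ‖fderiv ℝ (fun p => L (f p)) p‖ ≤ B := by
  obtain ⟨B, hB⟩ := hb
  refine ⟨‖L‖ * B, fun p => ?_⟩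
  have h : fderiv ℝ (fun p => L (f p)) p = L.comp (fderiv ℝ f p) :=
    (L.hasFDerivAt.comp p (hf p).hasFDerivAt).fderiv
  rw [h]
  refine (ContinuousLinearMap.opNorm_comp_le _ _).trans ?_
  gcongr
  exact hB p

end SecondOrderAveraging

/-- Second-order averaging on an infinite time interval. With
`G₁(z) = (1/T)∫₀ᵀ F₁(z,τ)dτ`, `w(z,t) = ∫₀ᵗ (F₁(z,τ) − G₁(z))dτ`,
`ψ₁(z,t) = w(z,t) − (1/T)∫₀ᵀ w(z,τ)dτ`,
`K₂(z,t) = F₂(z,t) + D_z F₁(z,t)·ψ₁(z,t) − D_z ψ₁(z,t)·G₁(z)`,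
`G₂(z) = (1/T)∫₀ᵀ K₂(z,τ)dτ`: if the origin is an exponentially stable equilibrium of
`ż = G₁(z)`, then there are a compact neighborhood `V` of the origin, `ε₀ > 0` and
`C > 0` such that for every `ε ∈ (0,ε₀)` and `z₀ ∈ V`, the solution `z` of the
truncated averaged system `ż = ε G₁(z) + ε² G₂(z)` with `z(t₀) = z₀` and the solution
`x` of `ẋ = ε F₁(x,t) + ε² F₂(x,t)` with `x(t₀) = z₀ + ε ψ₁(z₀,t₀)` exist on
`[t₀, ∞)` and satisfy `‖x(t) − z(t) − ε ψ₁(z(t),t)‖ < C ε²` for all `t ≥ t₀`. -/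
theorem second_order_averaging_infinite_time
    (n : ℕ) (T : ℝ) (hT : 0 < T)
    (F₁ F₂ : EuclideanSpace ℝ (Fin n) → ℝ → EuclideanSpace ℝ (Fin n))
    (G₁ G₂ : EuclideanSpace ℝ (Fin n) → EuclideanSpace ℝ (Fin n))
    (w ψ₁ K₂ : EuclideanSpace ℝ (Fin n) → ℝ → EuclideanSpace ℝ (Fin n))
    (hF₁_per : ∀ z, Function.Periodic (F₁ z) T)
    (hF₂_per : ∀ z, Function.Periodic (F₂ z) T)
    (hF₁_smooth : ContDiff ℝ 3 (Function.uncurry F₁))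
    (hF₂_smooth : ContDiff ℝ 2 (Function.uncurry F₂))
    (hF₁_bdd : ∃ B : ℝ, ∀ i : ℕ, i ≤ 3 →
      ∀ p : EuclideanSpace ℝ (Fin n) × ℝ,
        ‖iteratedFDeriv ℝ i (Function.uncurry F₁) p‖ ≤ B)
    (hF₂_bdd : ∃ B : ℝ, ∀ i : ℕ, i ≤ 2 →
      ∀ p : EuclideanSpace ℝ (Fin n) × ℝ,
        ‖iteratedFDeriv ℝ i (Function.uncurry F₂) p‖ ≤ B)
    (hG₁ : ∀ z, G₁ z = (1 / T) • ∫ τ in (0:ℝ)..T, F₁ z τ)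
    (hw : ∀ z t, w z t = ∫ τ in (0:ℝ)..t, (F₁ z τ - G₁ z))
    (hψ₁ : ∀ z t, ψ₁ z t = w z t - (1 / T) • ∫ τ in (0:ℝ)..T, w z τ)
    (hK₂ : ∀ z t, K₂ z t = F₂ z t
      + fderiv ℝ (fun y => F₁ y t) z (ψ₁ z t)
      - fderiv ℝ (fun y => ψ₁ y t) z (G₁ z))
    (hG₂ : ∀ z, G₂ z = (1 / T) • ∫ τ in (0:ℝ)..T, K₂ z τ)
    -- the origin is an exponentially stable equilibrium of ż = G₁(z)
    (hG₁0 : G₁ 0 = 0)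
    (hstab : ∃ δ K lam : ℝ, 0 < δ ∧ 0 < K ∧ 0 < lam ∧
      ∀ (t₀ : ℝ) (z : ℝ → EuclideanSpace ℝ (Fin n)),
        (∀ t ≥ t₀, HasDerivAt z (G₁ (z t)) t) → ‖z t₀‖ ≤ δ →
        ∀ t ≥ t₀, ‖z t‖ ≤ K * Real.exp (-lam * (t - t₀)) * ‖z t₀‖) :
    ∃ V : Set (EuclideanSpace ℝ (Fin n)), IsCompact V ∧ V ∈ nhds (0 : EuclideanSpace ℝ (Fin n)) ∧
      ∃ ε₀ C : ℝ, 0 < ε₀ ∧ 0 < C ∧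
        ∀ ε : ℝ, 0 < ε → ε < ε₀ → ∀ z₀ ∈ V, ∀ t₀ : ℝ,
          -- existence of the solutions on [t₀, ∞)
          (∃ z : ℝ → EuclideanSpace ℝ (Fin n), z t₀ = z₀ ∧
            ∀ t ≥ t₀, HasDerivAt z (ε • G₁ (z t) + (ε ^ 2) • G₂ (z t)) t) ∧
          (∃ x : ℝ → EuclideanSpace ℝ (Fin n), x t₀ = z₀ + ε • ψ₁ z₀ t₀ ∧
            ∀ t ≥ t₀, HasDerivAt x (ε • F₁ (x t) t + (ε ^ 2) • F₂ (x t) t) t) ∧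
          -- the closeness estimate on the infinite time interval
          (∀ z x : ℝ → EuclideanSpace ℝ (Fin n),
            z t₀ = z₀ → (∀ t ≥ t₀, HasDerivAt z (ε • G₁ (z t) + (ε ^ 2) • G₂ (z t)) t) →
            x t₀ = z₀ + ε • ψ₁ z₀ t₀ →
            (∀ t ≥ t₀, HasDerivAt x (ε • F₁ (x t) t + (ε ^ 2) • F₂ (x t) t) t) →
            ∀ t ≥ t₀, ‖x t - z t - ε • ψ₁ (z t) t‖ < C * ε ^ 2) := by
  have hper₁ (x t) : Function.uncurry F₁ (x, t + T) = Function.uncurry F₁ (x, t) := hF₁_per x t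
  have hper₂ (x t) : Function.uncurry F₂ (x, t + T) = Function.uncurry F₂ (x, t) := hF₂_per x t
  obtain ⟨B₁, hB₁⟩ := hF₁_bdd
  obtain ⟨B₂, hB₂⟩ := hF₂_bdd
  have h₁ := isPeriodicC1_of_contDiff (hF₁_smooth.of_le (by norm_num)) hper₁
    ⟨B₁, fun p => by simpa using hB₁ 0 (by norm_num) p⟩
    ⟨B₁, fun p => by simpa only [norm_iteratedFDeriv_one] using hB₁ 1 (by norm_num) p⟩
  have h₂ := isPeriodicC1_of_contDiff (hF₂_smooth.of_le (by norm_num)) hper₂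
    ⟨B₂, fun p => by simpa using hB₂ 0 (by norm_num) p⟩
    ⟨B₂, fun p => by simpa only [norm_iteratedFDeriv_one] using hB₂ 1 (by norm_num) p⟩
  have hdF : ContDiff ℝ 1 (fderiv ℝ (Function.uncurry F₁)) :=
    hF₁_smooth.fderiv_right (by norm_num)
  let L := (ContinuousLinearMap.compL ℝ (EuclideanSpace ℝ (Fin n)) _
    (EuclideanSpace ℝ (Fin n))).flip (ContinuousLinearMap.inl ℝ (EuclideanSpace ℝ (Fin n)) ℝ)
  have hA := isPeriodicC1_of_contDiff (T := T) (L.contDiff.comp hdF) h₁.right.per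
    (by
      obtain ⟨B, hB⟩ := h₁.right.bdd
      exact ⟨B, fun p => hB p.1 p.2⟩)
    (exists_norm_fderiv_clm_comp_le (hdF.differentiable one_ne_zero) L ⟨B₁, fun p => by
      rw [← norm_iteratedFDeriv_one, norm_iteratedFDeriv_fderiv]
      exact hB₁ 2 (by norm_num) p⟩)
  change IsPeriodicC1 T F₁ _ at h₁
  change IsPeriodicC1 T F₂ _ at h₂
  obtain rfl : G₁ = periodAvg T F₁ := funext hG₁
  obtain rfl : w = oscPrimitive T F₁ := funext₂ hw
  obtain rfl : ψ₁ = meanFreePrimitive T F₁ := funext₂ hψ₁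
  have hψ := h₁.meanFreePrimitive hT
  obtain rfl : K₂ = secondOrderField T F₁ F₂ _ := funext₂ fun z t => by
    rw [hK₂, (h₁.hasFDerivAt z t).fderiv, (hψ.hasFDerivAt z t).fderiv]
    rfl
  obtain rfl : G₂ = periodAvg T _ := funext hG₂
  obtain ⟨K', hK⟩ := IsPeriodicC1.exists_secondOrderField hT h₁ hA h₂
  obtain ⟨ρ, ε₀, C, hρ, hε₀, hC, hest⟩ :=
    exists_second_order_averaging_estimate hT h₁ hA h₂ hG₁0 hstab
  refine ⟨Metric.closedBall 0 ρ, isCompact_closedBall 0 ρ, Metric.closedBall_mem_nhds 0 hρ,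
    ε₀, C, hε₀, hC, fun ε hε hεlt z₀ hz₀ t₀ => ⟨?_, ?_, ?_⟩⟩
  · obtain ⟨z, hz0, hz⟩ := (((h₁.periodAvg hT).const_smul ε).add
      ((hK.periodAvg hT).const_smul (ε ^ 2))).exists_solution t₀ z₀
    exact ⟨z, hz0, fun t _ => hz t⟩
  · obtain ⟨x, hx0, hx⟩ := ((h₁.const_smul ε).add (h₂.const_smul (ε ^ 2))).exists_solution t₀
      (z₀ + ε • meanFreePrimitive T F₁ z₀ t₀)
    exact ⟨x, hx0, fun t _ => hx t⟩
  · rintro z x rfl hz hx0 hx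
    exact hest ε t₀ z x hε hεlt (by simpa using hz₀) hz hx0 hx
end

section
/- (Vanishing of the second-order averaged correction under zero-mean signal injection.) Let s : ℝ → ℝ be a continuous 1-periodic function with zero mean and S its zero-mean primitive. Let F̄₁ : ℝⁿ × ℝ → ℝⁿ and F̂₁ : ℝⁿ → ℝⁿ be C¹, and let F₂ : ℝⁿ × ℝ × ℝ → ℝⁿ be continuous, 1-periodic in its third argument with ∫₀¹ F₂(X, τ, σ) dσ = 0 for all X, τ. Set F₁(X, τ, σ) := F̄₁(X, τ) + F̂₁(X) s(σ), G₁(X, τ) := ∫₀¹ F₁(X, τ, σ) dσ = F̄₁(X, τ), W(X, σ) := F̂₁(X) S(σ), and K₂(X, τ, σ) := F₂(X, τ, σ) + D_X F₁(X, τ, σ)·W(X, σ) − D_X W(X, σ)·G₁(X, τ). Then for all X ∈ ℝⁿ and all τ ∈ ℝ: ∫₀¹ K₂(X, τ, σ) dσ = 0, i.e., the second-order averaged term G₂ vanishes identically. -/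
/-- A continuous function with zero mean over `[0, 1]` is orthogonal to any of its primitives. -/
theorem integral_mul_primitive_eq_zero {s S : ℝ → ℝ} (hs : Continuous s)
    (hS : ∀ σ, HasDerivAt S (s σ) σ) (hs_mean : (∫ σ in (0:ℝ)..1, s σ) = 0) :
    (∫ σ in (0:ℝ)..1, s σ * S σ) = 0 := by
  have hS_cont : Continuous S := continuous_iff_continuousAt.2 fun σ => (hS σ).continuousAt
  have hS_ends : S 1 = S 0 := by
    have h := intervalIntegral.integral_eq_sub_of_hasDerivAt (a := 0) (b := 1)
      (fun σ _ => hS σ) (hs.intervalIntegrable _ _)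
    linarith
  have h_deriv : ∀ σ, HasDerivAt (fun σ => S σ ^ 2 / 2) (s σ * S σ) σ := fun σ =>
    (((hS σ).pow 2).div_const 2).congr_deriv (by push_cast; ring)
  rw [intervalIntegral.integral_eq_sub_of_hasDerivAt (fun σ _ => h_deriv σ)
    ((hs.mul hS_cont).intervalIntegrable _ _), hS_ends, sub_self]

/-- Vanishing of the second-order averaged correction under zero-mean
signal injection. With `F₁(X,τ,σ) = F̄₁(X,τ) + F̂₁(X)s(σ)`, `G₁ = F̄₁`,
`W(X,σ) = F̂₁(X)S(σ)` and
`K₂(X,τ,σ) = F₂(X,τ,σ) + D_X F₁(X,τ,σ)·W(X,σ) − D_X W(X,σ)·G₁(X,τ)`,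
one has `∫₀¹ K₂(X,τ,σ) dσ = 0`. -/
theorem second_order_averaged_term_vanishes
    (n : ℕ) (s S : ℝ → ℝ)
    (hs_cont : Continuous s) (hs_per : Function.Periodic s 1)
    (hs_mean : (∫ σ in (0:ℝ)..1, s σ) = 0)
    (hS : ∀ σ : ℝ, S σ =
      (∫ τ in (0:ℝ)..σ, s τ) - ∫ μ in (0:ℝ)..1, ∫ τ in (0:ℝ)..μ, s τ)
    (Fbar : EuclideanSpace ℝ (Fin n) → ℝ → EuclideanSpace ℝ (Fin n))
    (Fhat : EuclideanSpace ℝ (Fin n) → EuclideanSpace ℝ (Fin n))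
    (F₂ : EuclideanSpace ℝ (Fin n) → ℝ → ℝ → EuclideanSpace ℝ (Fin n))
    (hFbar : ContDiff ℝ 1 (fun p : EuclideanSpace ℝ (Fin n) × ℝ => Fbar p.1 p.2))
    (hFhat : ContDiff ℝ 1 Fhat)
    (hF₂ : Continuous (fun p : EuclideanSpace ℝ (Fin n) × ℝ × ℝ => F₂ p.1 p.2.1 p.2.2))
    (hF₂_per : ∀ X τ, Function.Periodic (F₂ X τ) 1)
    (hF₂_mean : ∀ X τ, (∫ σ in (0:ℝ)..1, F₂ X τ σ) = 0) :
    ∀ (X : EuclideanSpace ℝ (Fin n)) (τ : ℝ),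
      (∫ σ in (0:ℝ)..1,
        (F₂ X τ σ
          + fderiv ℝ (fun Y => Fbar Y τ + s σ • Fhat Y) X (S σ • Fhat X)
          - fderiv ℝ (fun Y => S σ • Fhat Y) X (Fbar X τ))) = 0 := by
  intro X τ
  have hS_deriv : ∀ σ, HasDerivAt S (s σ) σ := by
    intro σ
    rw [funext hS]
    exact (intervalIntegral.integral_hasDerivAt_right (hs_cont.intervalIntegrable _ _)
      (hs_cont.stronglyMeasurableAtFilter _ _) hs_cont.continuousAt).sub_const _
  have hS_cont : Continuous S :=
    continuous_iff_continuousAt.2 fun σ => (hS_deriv σ).continuousAt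
  have hS_mean : (∫ σ in (0:ℝ)..1, S σ) = 0 := by
    have h_prim : Continuous fun σ => ∫ τ in (0:ℝ)..σ, s τ :=
      intervalIntegral.continuous_primitive (fun a b => hs_cont.intervalIntegrable a b) 0
    simp only [hS]
    rw [intervalIntegral.integral_sub (h_prim.intervalIntegrable _ _)
      intervalIntegrable_const]
    simp
  have hsS_mean := integral_mul_primitive_eq_zero hs_cont hS_deriv hs_mean
  have hFbar_diff : DifferentiableAt ℝ (fun Y => Fbar Y τ) X := by
    have h : ContDiff ℝ 1 fun Y => Fbar Y τ := hFbar.comp (contDiff_id.prodMk contDiff_const)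
    exact h.differentiable one_ne_zero X
  have hFhat_diff : DifferentiableAt ℝ Fhat X := hFhat.differentiable one_ne_zero X
  have hF₂_cont : Continuous (F₂ X τ) :=
    hF₂.comp (continuous_const.prodMk (continuous_const.prodMk continuous_id))
  have h_expand : ∀ σ : ℝ,
      F₂ X τ σ + fderiv ℝ (fun Y => Fbar Y τ + s σ • Fhat Y) X (S σ • Fhat X)
          - fderiv ℝ (fun Y => S σ • Fhat Y) X (Fbar X τ)
        = F₂ X τ σ + S σ • (fderiv ℝ (fun Y => Fbar Y τ) X (Fhat X) - fderiv ℝ Fhat X (Fbar X τ))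
          + (s σ * S σ) • fderiv ℝ Fhat X (Fhat X) := by
    intro σ
    rw [fderiv_fun_add hFbar_diff (hFhat_diff.fun_const_smul (s σ)),
      fderiv_fun_const_smul hFhat_diff, fderiv_fun_const_smul hFhat_diff]
    simp only [add_apply, smul_apply, map_smul]
    module
  simp only [h_expand]
  generalize fderiv ℝ (fun Y => Fbar Y τ) X (Fhat X) - fderiv ℝ Fhat X (Fbar X τ) = u
  generalize fderiv ℝ Fhat X (Fhat X) = v
  have h₁ : IntervalIntegrable (F₂ X τ) MeasureTheory.volume 0 1 :=
    hF₂_cont.intervalIntegrable _ _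
  have h₂ : IntervalIntegrable (fun σ => S σ • u) MeasureTheory.volume 0 1 :=
    (hS_cont.smul continuous_const).intervalIntegrable _ _
  have h₃ : IntervalIntegrable (fun σ => (s σ * S σ) • v) MeasureTheory.volume 0 1 :=
    ((hs_cont.mul hS_cont).smul continuous_const).intervalIntegrable _ _
  rw [intervalIntegral.integral_add (h₁.add h₂) h₃, intervalIntegral.integral_add h₁ h₂,
    intervalIntegral.integral_smul_const, intervalIntegral.integral_smul_const, hF₂_mean,
    hS_mean, hsS_mean]
  simp
end
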